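/- Let H* = inf{H(Ω) : Ω ⊊ ℝ² nonempty open simply connected}, the largest constant such that ∫_Ω ‖∇u‖² dx ≥ H* ∫_Ω u²/d² dx holds for all simply connected domains Ω ⊂ ℝ² and all u ∈ C_c^∞(Ω). Then 1/16 ≤ H* ≤ H(Λ_{2π}), where Λ_{2π} = ℝ² \ {(x, 0) : x ≥ 0} is the slit plane (the sector of angle 2π). -/

import Mathlib

open MeasureTheory Real

/-- The `L²` Hardy constant of an open set `Ω ⊆ ℝⁿ`: the supremum of constants `c ≥ 0`
such that `∫_Ω ‖∇u‖² ≥ c ∫_Ω u²/d²` for all `u ∈ C_c^∞(Ω)`, where `d(x) = dist(x, Ωᶜ)`. -/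
noncomputable def hardyConst {n : ℕ} (Ω : Set (EuclideanSpace ℝ (Fin n))) : ℝ :=
  sSup {c : ℝ | 0 ≤ c ∧ ∀ u : EuclideanSpace ℝ (Fin n) → ℝ,
    ContDiff ℝ (⊤ : ℕ∞) u → HasCompactSupport u → tsupport u ⊆ Ω →
    c * ∫ x in Ω, u x ^ 2 / Metric.infDist x Ωᶜ ^ 2 ≤ ∫ x in Ω, ‖gradient u x‖ ^ 2}

/-- The slit plane `Λ_{2π} = ℝ² \ {(x, 0) : x ≥ 0}`, the sector of angle `2π`. -/
def slitPlane : Set (EuclideanSpace ℝ (Fin 2)) :=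
  Set.univ \ {p : EuclideanSpace ℝ (Fin 2) | p 1 = 0 ∧ 0 ≤ p 0}

/-- The optimal uniform Hardy constant for simply connected planar domains:
`H* = inf{H(Ω) : Ω ⊊ ℝ² nonempty open simply connected}`. -/
noncomputable def simplyConnectedHardyConst : ℝ :=
  sInf {c : ℝ | ∃ Ω : Set (EuclideanSpace ℝ (Fin 2)),
    IsOpen Ω ∧ Ω.Nonempty ∧ Ω ≠ Set.univ ∧ SimplyConnectedSpace Ω ∧ c = hardyConst Ω}

/-- The disc automorphism `w ↦ (w - a) / (1 - conj a * w)`, which sends `a` to `0`. -/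
noncomputable def discAut (a w : ℂ) : ℂ := (w - a) / (1 - starRingEnd ℂ a * w)

theorem one_sub_conj_mul_ne_zero {a w : ℂ} (ha : ‖a‖ < 1) (hw : ‖w‖ < 1) :
    1 - starRingEnd ℂ a * w ≠ 0 := by
  intro h
  have h1 : ‖starRingEnd ℂ a * w‖ = 1 := by rw [← sub_eq_zero.mp h]; simp
  rw [norm_mul, Complex.norm_conj] at h1
  nlinarith [norm_nonneg a, norm_nonneg w]

theorem one_sub_norm_discAut_sq {a w : ℂ} (ha : ‖a‖ < 1) (hw : ‖w‖ < 1) :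
    1 - ‖discAut a w‖ ^ 2 =
      (1 - ‖a‖ ^ 2) * (1 - ‖w‖ ^ 2) / ‖1 - starRingEnd ℂ a * w‖ ^ 2 := by
  have h : ‖1 - starRingEnd ℂ a * w‖ ^ 2 ≠ 0 := by
    simpa using one_sub_conj_mul_ne_zero ha hw
  rw [discAut, norm_div, div_pow, eq_div_iff h, sub_mul, div_mul_cancel₀ _ h]
  simp only [← Complex.normSq_eq_norm_sq, Complex.normSq_apply]
  simp
  ring

theorem norm_discAut_lt_one {a w : ℂ} (ha : ‖a‖ < 1) (hw : ‖w‖ < 1) : ‖discAut a w‖ < 1 := by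
  have h : 0 < ‖1 - starRingEnd ℂ a * w‖ := by
    simpa using one_sub_conj_mul_ne_zero ha hw
  have h1 : 0 < 1 - ‖discAut a w‖ ^ 2 := by
    rw [one_sub_norm_discAut_sq ha hw]
    have : 0 < 1 - ‖a‖ ^ 2 := by nlinarith [norm_nonneg a]
    have : 0 < 1 - ‖w‖ ^ 2 := by nlinarith [norm_nonneg w]
    positivity
  nlinarith [norm_nonneg (discAut a w)]

theorem discAut_neg_discAut {a w : ℂ} (ha : ‖a‖ < 1) (hw : ‖w‖ < 1) :
    discAut (-a) (discAut a w) = w := by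
  have h0 := one_sub_conj_mul_ne_zero ha hw
  have h1 := one_sub_conj_mul_ne_zero (a := -a) (by simpa using ha) (norm_discAut_lt_one ha hw)
  rw [discAut, div_eq_iff h1, discAut]
  simp only [map_neg]
  generalize starRingEnd ℂ a = c at *
  have h3 : (1 - c * w) * ((w - a) / (1 - c * w)) = w - a := mul_div_cancel₀ _ h0
  linear_combination h3

theorem injOn_discAut {a : ℂ} (ha : ‖a‖ < 1) : Set.InjOn (discAut a) (Metric.ball 0 1) := by
  intro w hw z hz h
  rw [mem_ball_zero_iff] at hw hz
  rw [← discAut_neg_discAut ha hw, h, discAut_neg_discAut ha hz]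

theorem hasDerivAt_discAut {a w : ℂ} (ha : ‖a‖ < 1) (hw : ‖w‖ < 1) :
    HasDerivAt (discAut a) ((1 - ‖a‖ ^ 2 : ℝ) / (1 - starRingEnd ℂ a * w) ^ 2) w := by
  have h0 := one_sub_conj_mul_ne_zero ha hw
  have h := ((hasDerivAt_id w).sub_const a).div
    (((hasDerivAt_id w).const_mul (starRingEnd ℂ a)).const_sub 1) h0
  refine h.congr_deriv ?_
  congr 1
  push_cast
  rw [← Complex.conj_mul']
  simp
  ring

theorem discAut_ne_zero {a w : ℂ} (ha : ‖a‖ < 1) (hw : ‖w‖ < 1) (h : w ≠ a) :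
    discAut a w ≠ 0 :=
  div_ne_zero (sub_ne_zero.mpr h) (one_sub_conj_mul_ne_zero ha hw)

theorem discAut_self (a : ℂ) : discAut a a = 0 := by simp [discAut]

theorem discAut_zero (a : ℂ) : discAut a 0 = -a := by simp [discAut]

/-- A half-radius form of the Schwarz–Pick lemma. -/
theorem one_sub_norm_sq_le_of_mapsTo_ball {g : ℂ → ℂ} {a b : ℂ} {δ : ℝ}
    (hg : DifferentiableOn ℂ g (Metric.ball a δ))
    (hm : Set.MapsTo g (Metric.ball a δ) (Metric.ball 0 1)) (hδ : 0 < δ)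
    (hb : dist b a ≤ δ / 2) :
    3 / 16 * (1 - ‖g a‖ ^ 2) ≤ 1 - ‖g b‖ ^ 2 := by
  have hm' : ∀ z ∈ Metric.ball a δ, ‖g z‖ < 1 := fun z hz => by simpa using hm hz
  have hbm : b ∈ Metric.ball a δ := by rw [Metric.mem_ball]; linarith
  have ha := hm' a (Metric.mem_ball_self hδ)
  have hb1 := hm' b hbm
  set ψ : ℂ → ℂ := fun z => discAut (g a) (g z) with hψ
  have hψd : DifferentiableOn ℂ ψ (Metric.ball a δ) := fun z hz =>
    ((hasDerivAt_discAut ha (hm' z hz)).differentiableAt.comp_differentiableWithinAt z (hg z hz))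
  have hψa : ψ a = 0 := discAut_self _
  have hψm : Set.MapsTo ψ (Metric.ball a δ) (Metric.closedBall (ψ a) 1) := fun z hz => by
    rw [hψa, mem_closedBall_zero_iff]; exact (norm_discAut_lt_one ha (hm' z hz)).le
  have h1 := Complex.dist_le_div_mul_dist_of_mapsTo_ball hψd hψm hbm
  have h2 : ‖ψ b‖ ≤ 1 / 2 := by
    rw [hψa, dist_zero_right] at h1
    refine h1.trans ?_
    rw [div_mul_eq_mul_div, div_le_iff₀ hδ]; linarith
  have h2' : ‖ψ b‖ < 1 := by linarith
  have hna : ‖-g a‖ < 1 := by simpa using ha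
  have h3 : g b = discAut (-g a) (ψ b) := (discAut_neg_discAut ha hb1).symm
  have h4 := one_sub_norm_discAut_sq hna h2'
  rw [h3, h4, norm_neg]
  have h5 : 0 < ‖1 - starRingEnd ℂ (-g a) * ψ b‖ := by
    simpa using one_sub_conj_mul_ne_zero hna h2'
  have h6 : ‖1 - starRingEnd ℂ (-g a) * ψ b‖ ≤ 2 := by
    refine (norm_sub_le _ _).trans ?_
    rw [norm_mul, Complex.norm_conj, norm_one, norm_neg]
    nlinarith [norm_nonneg (g a), norm_nonneg (ψ b)]
  rw [le_div_iff₀ (by positivity)]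
  have h7 : 0 < 1 - ‖g a‖ ^ 2 := by nlinarith [norm_nonneg (g a)]
  have h8 : 3 / 4 ≤ 1 - ‖ψ b‖ ^ 2 := by nlinarith [norm_nonneg (ψ b)]
  have h9 : ‖1 - starRingEnd ℂ (-g a) * ψ b‖ ^ 2 ≤ 4 := by nlinarith
  nlinarith [mul_le_mul_of_nonneg_left h9 h7.le, mul_le_mul_of_nonneg_left h8 h7.le]

/-- Holomorphic square roots on simply connected open sets. -/
theorem exists_differentiableOn_sq_eq {U : Set ℂ} (hUo : IsOpen U) (hUc : IsSimplyConnected U)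
    {g : ℂ → ℂ} (hg : DifferentiableOn ℂ g U) (h0 : ∀ z ∈ U, g z ≠ 0) :
    ∃ k : ℂ → ℂ, DifferentiableOn ℂ k U ∧ ∀ z ∈ U, k z ^ 2 = g z := by
  obtain ⟨k, hkc, hk⟩ := Complex.exists_continuousOn_pow_eq hUc hUo hg.continuousOn
    (by rintro ⟨z, hz, h⟩; exact h0 z hz h) two_ne_zero
  refine ⟨k, fun z hz => ?_, fun z _ => hk z⟩
  have hkz : k z ≠ 0 := fun h => h0 z hz (by rw [← hk z, h]; simp)
  have hcont : ContinuousAt k z := hkc.continuousAt (hUo.mem_nhds hz)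
  have hgd : HasDerivAt g (deriv g z) z := (hg.differentiableAt (hUo.mem_nhds hz)).hasDerivAt
  refine (HasDerivAt.differentiableAt (f' := deriv g z / (2 * k z)) ?_).differentiableWithinAt
  rw [hasDerivAt_iff_tendsto_slope] at hgd ⊢
  have hlim : Filter.Tendsto (fun y => slope g z y / (k y + k z)) (nhdsWithin z {z}ᶜ)
      (nhds (deriv g z / (2 * k z))) := by
    refine hgd.div ?_ (by simpa using hkz)
    have := (hcont.tendsto.add_const (k z)).mono_left (nhdsWithin_le_nhds (s := {z}ᶜ))
    rwa [← two_mul] at this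
  refine hlim.congr' ?_
  have hne : ∀ᶠ y in nhdsWithin z {z}ᶜ, k y + k z ≠ 0 := by
    have h := (hcont.tendsto.add_const (k z)).mono_left (nhdsWithin_le_nhds (s := {z}ᶜ))
    refine h.eventually_ne ?_
    rw [← two_mul]; simpa using hkz
  filter_upwards [hne] with y hy
  rw [slope_def_field, slope_def_field, ← hk y, ← hk z]
  field_simp
  ring

/-- Injective holomorphic maps of `U` into the unit disc, without critical points, that send `z₀`
to `0`. -/
structure IsNormalizedEmbedding (U : Set ℂ) (z₀ : ℂ) (g : ℂ → ℂ) : Prop where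
  differentiableOn : DifferentiableOn ℂ g U
  norm_lt_one : ∀ z ∈ U, ‖g z‖ < 1
  injOn : Set.InjOn g U
  deriv_ne_zero : ∀ z ∈ U, deriv g z ≠ 0
  map_base : g z₀ = 0

theorem hasDerivAt_of_sq_eq {U : Set ℂ} (hUo : IsOpen U) {g k : ℂ → ℂ}
    (hk : DifferentiableOn ℂ k U) (h : ∀ z ∈ U, k z ^ 2 = g z) {z g' : ℂ} (hz : z ∈ U)
    (hg : HasDerivAt g g' z) : 2 * k z * deriv k z = g' := by
  have h1 := ((hk.differentiableAt (hUo.mem_nhds hz)).hasDerivAt.pow 2)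
  have h2 : (k ^ 2) =ᶠ[nhds z] g := by
    filter_upwards [hUo.mem_nhds hz] with y hy using h y hy
  have := (h1.congr_of_eventuallyEq h2.symm).unique hg
  simpa using this

/-- Composing an injective map into the disc with a disc automorphism normalizes it. -/
theorem isNormalizedEmbedding_discAut_comp {U : Set ℂ} (hUo : IsOpen U) {z₀ : ℂ} (hz₀ : z₀ ∈ U)
    {g : ℂ → ℂ} (hd : DifferentiableOn ℂ g U) (hm : ∀ z ∈ U, ‖g z‖ < 1) (hi : Set.InjOn g U)
    (h' : ∀ z ∈ U, deriv g z ≠ 0) :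
    IsNormalizedEmbedding U z₀ (fun z => discAut (g z₀) (g z)) ∧
      ‖deriv (fun z => discAut (g z₀) (g z)) z₀‖ * (1 - ‖g z₀‖ ^ 2) = ‖deriv g z₀‖ := by
  have ha := hm z₀ hz₀
  have hD : ∀ z ∈ U, HasDerivAt (fun z => discAut (g z₀) (g z))
      ((1 - ‖g z₀‖ ^ 2 : ℝ) / (1 - starRingEnd ℂ (g z₀) * g z) ^ 2 * deriv g z) z := fun z hz =>
    (hasDerivAt_discAut ha (hm z hz)).comp z (hd.differentiableAt (hUo.mem_nhds hz)).hasDerivAt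
  have hpos : 0 < 1 - ‖g z₀‖ ^ 2 := by nlinarith [norm_nonneg (g z₀)]
  refine ⟨⟨fun z hz => (hD z hz).differentiableAt.differentiableWithinAt,
    fun z hz => norm_discAut_lt_one ha (hm z hz), ?_, ?_, discAut_self _⟩, ?_⟩
  · intro z hz w hw h
    exact hi hz hw (injOn_discAut ha (by simpa using hm z hz) (by simpa using hm w hw) h)
  · intro z hz
    rw [(hD z hz).deriv]
    refine mul_ne_zero (div_ne_zero ?_ (pow_ne_zero _ ?_)) (h' z hz)
    · exact_mod_cast hpos.ne'
    · exact one_sub_conj_mul_ne_zero ha (hm z hz)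
  · rw [(hD z₀ hz₀).deriv, Complex.conj_mul', norm_mul, norm_div, norm_pow]
    have : ((1 : ℂ) - (‖g z₀‖ : ℂ) ^ 2) = ((1 - ‖g z₀‖ ^ 2 : ℝ) : ℂ) := by push_cast; rfl
    rw [this, Complex.norm_real, Real.norm_of_nonneg hpos.le]
    field_simp

theorem exists_isNormalizedEmbedding {U : Set ℂ} (hUo : IsOpen U) (hUc : IsSimplyConnected U)
    (hU : U ≠ Set.univ) {z₀ : ℂ} (hz₀ : z₀ ∈ U) : ∃ g, IsNormalizedEmbedding U z₀ g := by
  obtain ⟨a, ha⟩ := (Set.ne_univ_iff_exists_notMem U).mp hU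
  obtain ⟨k, hkd, hk⟩ := exists_differentiableOn_sq_eq hUo hUc
    (g := fun z => z - a) (by fun_prop)
    (fun z hz h => ha (sub_eq_zero.mp h ▸ hz))
  have hk0 : ∀ z ∈ U, k z ≠ 0 := fun z hz h => ha <| by
    have := hk z hz
    rw [h, zero_pow two_ne_zero] at this
    exact sub_eq_zero.mp this.symm ▸ hz
  have hki : ∀ z ∈ U, ∀ w ∈ U, k z ^ 2 = k w ^ 2 → z = w := fun z hz w hw h => by
    rw [hk z hz, hk w hw] at h
    simpa using h
  have hk' : ∀ z ∈ U, 2 * k z * deriv k z = 1 := fun z hz =>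
    hasDerivAt_of_sq_eq hUo hkd hk hz ((hasDerivAt_id z).sub_const a)
  have hk'0 : ∀ z ∈ U, deriv k z ≠ 0 := fun z hz h => by simpa [h] using hk' z hz
  have hnhds : k '' U ∈ nhds (k z₀) := by
    have hs := (hkd.analyticAt (hUo.mem_nhds hz₀)).hasStrictDerivAt
    rw [← hs.map_nhds_eq (hk'0 z₀ hz₀)]
    exact Filter.image_mem_map (hUo.mem_nhds hz₀)
  obtain ⟨ε, hε, hball⟩ := Metric.mem_nhds_iff.mp hnhds
  have hfar : ∀ z ∈ U, ε ≤ ‖k z + k z₀‖ := by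
    intro z hz
    by_contra! hlt
    have : -k z ∈ Metric.ball (k z₀) ε := by
      rw [Metric.mem_ball, dist_eq_norm, ← norm_neg]; simpa [add_comm] using hlt
    obtain ⟨w, hw, hwz⟩ := hball this
    have := hki w hw z hz (by rw [hwz]; ring)
    subst this
    exact hk0 w hw (by linear_combination hwz / 2)
  have hne : ∀ z ∈ U, k z + k z₀ ≠ 0 := fun z hz h => by
    have := hfar z hz
    rw [h, norm_zero] at this
    linarith
  have hD : ∀ z ∈ U, HasDerivAt (fun z => (ε / 2 : ℂ) / (k z + k z₀))
      (-((ε / 2 : ℂ) * deriv k z) / (k z + k z₀) ^ 2) z := fun z hz => by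
    have := (hasDerivAt_const z (ε / 2 : ℂ)).fun_div
      ((hkd.differentiableAt (hUo.mem_nhds hz)).hasDerivAt.add_const (k z₀)) (hne z hz)
    simpa using this
  have hεC : (ε / 2 : ℂ) ≠ 0 := by simpa using hε.ne'
  refine ⟨_, (isNormalizedEmbedding_discAut_comp hUo hz₀
    (g := fun z => (ε / 2 : ℂ) / (k z + k z₀))
    (fun z hz => (hD z hz).differentiableAt.differentiableWithinAt) ?_ ?_ ?_).1⟩
  · intro z hz
    have h1 := hfar z hz
    rw [norm_div, div_lt_one (by linarith)]
    have : ‖(ε / 2 : ℂ)‖ = ε / 2 := by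
      rw [norm_div, Complex.norm_real, Real.norm_of_nonneg hε.le]; simp
    linarith
  · intro z hz w hw h
    have h1 : k z + k z₀ = k w + k z₀ := by
      have := (div_eq_div_iff (hne z hz) (hne w hw)).mp h
      exact (mul_left_cancel₀ hεC this).symm
    exact hki z hz w hw (by rw [add_right_cancel h1])
  · intro z hz
    rw [(hD z hz).deriv]
    exact div_ne_zero (neg_ne_zero.mpr (mul_ne_zero hεC (hk'0 z hz))) (pow_ne_zero _ (hne z hz))

/-- The Koebe–Carathéodory square root step: an embedding omitting a value of the disc can be
replaced by one with larger derivative at the base point. -/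
theorem IsNormalizedEmbedding.exists_deriv_eq_of_notMem {U : Set ℂ} (hUo : IsOpen U)
    (hUc : IsSimplyConnected U) {z₀ : ℂ} (hz₀ : z₀ ∈ U) {g : ℂ → ℂ}
    (hg : IsNormalizedEmbedding U z₀ g) {w : ℂ} (hw : ‖w‖ < 1) (hwU : ∀ z ∈ U, g z ≠ w) :
    ∃ g₂ s, IsNormalizedEmbedding U z₀ g₂ ∧ 0 < s ∧ s ^ 2 = ‖w‖ ∧
      2 * s * ‖deriv g₂ z₀‖ = (1 + s ^ 2) * ‖deriv g z₀‖ := by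
  have hD : ∀ z ∈ U, HasDerivAt (fun z => discAut w (g z))
      ((1 - ‖w‖ ^ 2 : ℝ) / (1 - starRingEnd ℂ w * g z) ^ 2 * deriv g z) z := fun z hz =>
    (hasDerivAt_discAut hw (hg.norm_lt_one z hz)).comp z
      (hg.differentiableOn.differentiableAt (hUo.mem_nhds hz)).hasDerivAt
  have hpos : 0 < 1 - ‖w‖ ^ 2 := by nlinarith [norm_nonneg w]
  have hD0 : ∀ z ∈ U, (1 - ‖w‖ ^ 2 : ℝ) / (1 - starRingEnd ℂ w * g z) ^ 2 * deriv g z ≠ 0 := by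
    intro z hz
    refine mul_ne_zero (div_ne_zero ?_ (pow_ne_zero _ ?_)) (hg.deriv_ne_zero z hz)
    · exact_mod_cast hpos.ne'
    · exact one_sub_conj_mul_ne_zero hw (hg.norm_lt_one z hz)
  obtain ⟨k, hkd, hk⟩ := exists_differentiableOn_sq_eq hUo hUc
    (g := fun z => discAut w (g z))
    (fun z hz => (hD z hz).differentiableAt.differentiableWithinAt)
    (fun z hz => discAut_ne_zero hw (hg.norm_lt_one z hz) (hwU z hz))
  have hk' : ∀ z ∈ U, _ := fun z hz => hasDerivAt_of_sq_eq hUo hkd hk hz (hD z hz)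
  have hkm : ∀ z ∈ U, ‖k z‖ < 1 := by
    intro z hz
    have h1 : ‖k z‖ ^ 2 < 1 := by
      rw [← norm_pow, hk z hz]
      exact norm_discAut_lt_one hw (hg.norm_lt_one z hz)
    nlinarith [norm_nonneg (k z)]
  obtain ⟨hN, hder⟩ := isNormalizedEmbedding_discAut_comp hUo hz₀ hkd hkm
    (fun z hz y hy h => hg.injOn hz hy (injOn_discAut hw
      (by simpa using hg.norm_lt_one z hz) (by simpa using hg.norm_lt_one y hy)
      (by simp only [← hk z hz, ← hk y hy, h])))
    (fun z hz h => hD0 z hz (by rw [← hk' z hz, h, mul_zero]))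
  have hs2 : ‖k z₀‖ ^ 2 = ‖w‖ := by
    rw [← norm_pow, hk z₀ hz₀, hg.map_base, discAut_zero, norm_neg]
  have hw0 : w ≠ 0 := fun h => hwU z₀ hz₀ (by rw [hg.map_base, h])
  have hs0 : 0 < ‖k z₀‖ := by
    rcases (norm_nonneg (k z₀)).eq_or_lt with h | h
    · rw [← h] at hs2
      exact absurd (norm_eq_zero.mp (by simpa using hs2.symm)) hw0
    · exact h
  refine ⟨_, ‖k z₀‖, hN, hs0, hs2, ?_⟩
  have h1 : 2 * ‖k z₀‖ * ‖deriv k z₀‖ = (1 - ‖w‖ ^ 2) * ‖deriv g z₀‖ := by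
    have := congrArg norm (hk' z₀ hz₀)
    rw [hg.map_base] at this
    simp only [norm_mul, mul_zero, sub_zero, one_pow, div_one, Complex.norm_real,
      Real.norm_of_nonneg hpos.le] at this
    simpa using this
  have h2 : 0 < 1 - ‖k z₀‖ ^ 2 := by rw [hs2]; linarith
  have h3 := mul_pos h2 hs0
  rw [← hder, ← hs2] at h1
  refine mul_right_cancel₀ h2.ne' ?_
  linear_combination h1

theorem exists_isNormalizedEmbedding_ball_subset {U : Set ℂ} (hUo : IsOpen U)
    (hUc : IsSimplyConnected U) (hU : U ≠ Set.univ) {z₀ : ℂ} (hz₀ : z₀ ∈ U) {t : ℝ}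
    (ht0 : 0 < t) (ht1 : t < 1) :
    ∃ g, IsNormalizedEmbedding U z₀ g ∧ Metric.ball 0 (t ^ 2) ⊆ g '' U := by
  set S : Set ℝ := {c | ∃ g, IsNormalizedEmbedding U z₀ g ∧ c = ‖deriv g z₀‖} with hS
  obtain ⟨δ, hδ, hball⟩ := Metric.mem_nhds_iff.mp (hUo.mem_nhds hz₀)
  have hbdd : BddAbove S := by
    refine ⟨1 / δ, ?_⟩
    rintro _ ⟨g, hg, rfl⟩
    refine Complex.norm_deriv_le_div_of_mapsTo_ball (hg.differentiableOn.mono hball) ?_ hδ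
    intro z hz
    rw [hg.map_base, mem_closedBall_zero_iff]
    exact (hg.norm_lt_one z (hball hz)).le
  obtain ⟨g₀, hg₀⟩ := exists_isNormalizedEmbedding hUo hUc hU hz₀
  have hpos : 0 < sSup S :=
    lt_of_lt_of_le (norm_pos_iff.mpr (hg₀.deriv_ne_zero z₀ hz₀)) (le_csSup hbdd ⟨g₀, hg₀, rfl⟩)
  have hlt : sSup S * (2 * t) / (1 + t ^ 2) < sSup S := by
    rw [div_lt_iff₀ (by positivity)]
    nlinarith [mul_pos hpos (pow_pos (sub_pos.mpr ht1) 2)]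
  obtain ⟨_, ⟨g, hg, rfl⟩, hlt'⟩ := exists_lt_of_lt_csSup (s := S) ⟨_, g₀, hg₀, rfl⟩ hlt
  refine ⟨g, hg, fun w hw => ?_⟩
  by_contra hwU
  have hw' : ‖w‖ < t ^ 2 := by simpa using hw
  obtain ⟨g₂, s, hg₂, hs0, hs2, hder⟩ := hg.exists_deriv_eq_of_notMem hUo hUc hz₀
    (w := w) (by nlinarith) (fun z hz h => hwU ⟨z, hz, h⟩)
  have h1 : ‖deriv g₂ z₀‖ ≤ sSup S := le_csSup hbdd ⟨g₂, hg₂, rfl⟩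
  rw [div_lt_iff₀ (by positivity)] at hlt'
  have hst : s < t := by
    rw [← hs2] at hw'
    exact lt_of_pow_lt_pow_left₀ 2 ht0.le hw'
  have h2 : (1 + s ^ 2) * ‖deriv g z₀‖ ≤ 2 * s * sSup S := by
    rw [← hder]; gcongr
  have h3 : (1 + s ^ 2) * (sSup S * (2 * t)) < 2 * s * sSup S * (1 + t ^ 2) := by
    nlinarith [mul_lt_mul_of_pos_left hlt' (show 0 < 1 + s ^ 2 by positivity),
      mul_le_mul_of_nonneg_right h2 (show 0 ≤ 1 + t ^ 2 by positivity)]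
  have h4 : 0 < (t - s) * (1 - s * t) := mul_pos (sub_pos.mpr hst) (by nlinarith)
  nlinarith [mul_pos hpos h4]

/-- Normalized embeddings stay uniformly away from the unit circle on compact sets. -/
theorem exists_lt_one_forall_norm_le {U : Set ℂ} (hUo : IsOpen U) (hUc : IsPreconnected U)
    {z₀ : ℂ} (hz₀ : z₀ ∈ U) {K : Set ℂ} (hK : IsCompact K) (hKU : K ⊆ U) :
    ∃ c : ℝ, 0 < c ∧ ∀ g, IsNormalizedEmbedding U z₀ g → ∀ z ∈ K, c ≤ 1 - ‖g z‖ ^ 2 := by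
  have hloc : ∀ a ∈ U, ∃ ε > 0, Metric.ball a ε ⊆ U ∧ ∀ b ∈ Metric.ball a ε,
      ∀ g, IsNormalizedEmbedding U z₀ g →
        3 / 16 * (1 - ‖g a‖ ^ 2) ≤ 1 - ‖g b‖ ^ 2 ∧ 3 / 16 * (1 - ‖g b‖ ^ 2) ≤ 1 - ‖g a‖ ^ 2 := by
    intro a ha
    obtain ⟨δ, hδ, hball⟩ := Metric.mem_nhds_iff.mp (hUo.mem_nhds ha)
    refine ⟨δ / 4, by positivity,
      (Metric.ball_subset_ball (by linarith)).trans hball, fun b hb g hg => ?_⟩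
    have hm : Set.MapsTo g U (Metric.ball 0 1) := fun z hz => by
      simpa using hg.norm_lt_one z hz
    rw [Metric.mem_ball] at hb
    have hsub : Metric.ball b (δ / 2) ⊆ U :=
      (Metric.ball_subset_ball' (by linarith)).trans hball
    exact ⟨one_sub_norm_sq_le_of_mapsTo_ball (hg.differentiableOn.mono hball)
        (hm.mono_left hball) hδ (by linarith),
      one_sub_norm_sq_le_of_mapsTo_ball (hg.differentiableOn.mono hsub)
        (hm.mono_left hsub) (by linarith) (by rw [dist_comm]; linarith)⟩
  set P : ℂ → Prop := fun z => ∃ c : ℝ, 0 < c ∧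
    ∀ g, IsNormalizedEmbedding U z₀ g → c ≤ 1 - ‖g z‖ ^ 2 with hP
  have hopen : IsOpen {z ∈ U | P z} := by
    refine Metric.isOpen_iff.mpr fun a ⟨ha, c, hc, h⟩ => ?_
    obtain ⟨ε, hε, hsub, hcomp⟩ := hloc a ha
    refine ⟨ε, hε, fun b hb => ⟨hsub hb, 3 / 16 * c, by positivity, fun g hg => ?_⟩⟩
    linarith [(hcomp b hb g hg).1, h g hg]
  have hopen' : IsOpen {z ∈ U | ¬ P z} := by
    refine Metric.isOpen_iff.mpr fun a ⟨ha, hna⟩ => ?_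
    obtain ⟨ε, hε, hsub, hcomp⟩ := hloc a ha
    refine ⟨ε, hε, fun b hb => ⟨hsub hb, fun ⟨c, hc, h⟩ => hna
      ⟨3 / 16 * c, by positivity, fun g hg => ?_⟩⟩⟩
    linarith [(hcomp b hb g hg).2, h g hg]
  have hall : U ⊆ {z ∈ U | P z} := by
    refine IsPreconnected.subset_left_of_subset_union hopen hopen' ?_ ?_ ?_ hUc
    · rw [Set.disjoint_left]
      exact fun z hz hz' => hz'.2 hz.2
    · intro z hz
      by_cases h : P z
      · exact Or.inl ⟨hz, h⟩
      · exact Or.inr ⟨hz, h⟩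
    · exact ⟨z₀, hz₀, hz₀, 1, one_pos, fun g hg => by simp [hg.map_base]⟩
  refine hK.induction_on (p := fun K => ∃ c : ℝ, 0 < c ∧
    ∀ g, IsNormalizedEmbedding U z₀ g → ∀ z ∈ K, c ≤ 1 - ‖g z‖ ^ 2) ?_ ?_ ?_ ?_
  · exact ⟨1, one_pos, fun _ _ _ h => absurd h (Set.notMem_empty _)⟩
  · rintro s t hst ⟨c, hc, h⟩
    exact ⟨c, hc, fun g hg z hz => h g hg z (hst hz)⟩
  · rintro s t ⟨c, hc, h⟩ ⟨c', hc', h'⟩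
    refine ⟨min c c', lt_min hc hc', fun g hg z hz => ?_⟩
    rcases hz with hz | hz
    · exact (min_le_left _ _).trans (h g hg z hz)
    · exact (min_le_right _ _).trans (h' g hg z hz)
  · intro a ha
    obtain ⟨-, c, hc, h⟩ := hall (hKU ha)
    obtain ⟨ε, hε, hsub, hcomp⟩ := hloc a (hKU ha)
    refine ⟨Metric.ball a ε, mem_nhdsWithin_of_mem_nhds (Metric.ball_mem_nhds a hε),
      3 / 16 * c, by positivity, fun g hg b hb => ?_⟩
    linarith [(hcomp b hb g hg).1, h g hg]

/-- Every compact subset of a simply connected proper open subset `U` of the plane lies in an open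
subset of `U` which is conformally equivalent to the unit disc. -/
theorem exists_conformal_disc_of_isCompact {U : Set ℂ} (hUo : IsOpen U)
    (hUc : IsSimplyConnected U) (hU : U ≠ Set.univ) {K : Set ℂ} (hK : IsCompact K)
    (hKU : K ⊆ U) :
    ∃ (V : Set ℂ) (p : ℂ → ℂ), IsOpen V ∧ K ⊆ V ∧ V ⊆ U ∧ DifferentiableOn ℂ p V ∧ Set.InjOn p V ∧
      (∀ z ∈ V, deriv p z ≠ 0) ∧ p '' V = Metric.ball 0 1 := by
  obtain ⟨z₀, hz₀⟩ := hUc.nonempty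
  obtain ⟨c, hc, h⟩ := exists_lt_one_forall_norm_le hUo
    hUc.isPathConnected.isConnected.isPreconnected hz₀ hK hKU
  obtain ⟨t, ht0, ht1, ht⟩ : ∃ t : ℝ, 0 < t ∧ t < 1 ∧ 1 - c < t ^ 4 := by
    have hlim : Filter.Tendsto (fun t : ℝ => t ^ 4) (nhdsWithin 1 (Set.Iio 1)) (nhds 1) := by
      have : ContinuousAt (fun t : ℝ => t ^ 4) 1 := by fun_prop
      simpa using this.tendsto.mono_left nhdsWithin_le_nhds
    have h1 := hlim.eventually (lt_mem_nhds (show 1 - c < 1 by linarith))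
    have h2 : ∀ᶠ t : ℝ in nhdsWithin 1 (Set.Iio 1), t ∈ Set.Ioo (0 : ℝ) 1 :=
      Ioo_mem_nhdsLT one_pos
    obtain ⟨t, ht, ht'⟩ := (h1.and h2).exists
    exact ⟨t, ht'.1, ht'.2, ht⟩
  obtain ⟨g, hg, hball⟩ := exists_isNormalizedEmbedding_ball_subset hUo hUc hU hz₀ ht0 ht1
  have hr : 0 < t ^ 2 := by positivity
  have hrC : ((t ^ 2 : ℝ) : ℂ) ≠ 0 := by exact_mod_cast hr.ne'
  have hDd : ∀ z ∈ U, HasDerivAt (fun z => g z / ((t ^ 2 : ℝ) : ℂ))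
      (deriv g z / ((t ^ 2 : ℝ) : ℂ)) z := fun z hz =>
    (hg.differentiableOn.differentiableAt (hUo.mem_nhds hz)).hasDerivAt.div_const _
  refine ⟨U ∩ g ⁻¹' Metric.ball 0 (t ^ 2), fun z => g z / ((t ^ 2 : ℝ) : ℂ), ?_, ?_,
    Set.inter_subset_left, ?_, ?_, ?_, ?_⟩
  · exact hg.differentiableOn.continuousOn.isOpen_inter_preimage hUo Metric.isOpen_ball
  · intro z hz
    refine ⟨hKU hz, ?_⟩
    have h1 := h g hg z hz
    rw [Set.mem_preimage, mem_ball_zero_iff]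
    refine lt_of_pow_lt_pow_left₀ 2 hr.le ?_
    nlinarith
  · exact fun z hz => (hDd z hz.1).differentiableAt.differentiableWithinAt
  · intro z hz w hw hzw
    exact hg.injOn hz.1 hw.1 ((div_left_inj' hrC).mp hzw)
  · intro z hz
    rw [(hDd z hz.1).deriv]
    exact div_ne_zero (hg.deriv_ne_zero z hz.1) hrC
  · ext w
    constructor
    · rintro ⟨z, hz, rfl⟩
      have := hz.2
      rw [Set.mem_preimage, mem_ball_zero_iff] at this
      rw [mem_ball_zero_iff, norm_div, Complex.norm_real, Real.norm_of_nonneg hr.le]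
      exact (div_lt_one hr).mpr this
    · intro hw
      rw [mem_ball_zero_iff] at hw
      have hmem : w * ((t ^ 2 : ℝ) : ℂ) ∈ Metric.ball (0 : ℂ) (t ^ 2) := by
        rw [mem_ball_zero_iff, norm_mul, Complex.norm_real, Real.norm_of_nonneg hr.le]
        nlinarith
      obtain ⟨z, hz, hzw⟩ := hball hmem
      refine ⟨z, ⟨hz, ?_⟩, ?_⟩
      · rw [Set.mem_preimage, hzw]; exact hmem
      · simp only [hzw]
        exact mul_div_cancel_right₀ _ hrC

/-- The open annulus centred at `0`. -/
def annulus (a b : ℝ) : Set ℂ := {z | a < ‖z‖ ∧ ‖z‖ < b}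

theorem isOpen_annulus (a b : ℝ) : IsOpen (annulus a b) :=
  (isOpen_lt continuous_const continuous_norm).inter (isOpen_lt continuous_norm continuous_const)

theorem isCompact_closedAnnulus (a b : ℝ) : IsCompact {z : ℂ | a ≤ ‖z‖ ∧ ‖z‖ ≤ b} := by
  refine (isCompact_closedBall (0 : ℂ) b).of_isClosed_subset ?_ fun z hz => by simpa using hz.2
  exact (isClosed_le continuous_const continuous_norm).inter
    (isClosed_le continuous_norm continuous_const)

theorem annulus_subset_closedAnnulus (a b : ℝ) : annulus a b ⊆ {z : ℂ | a ≤ ‖z‖ ∧ ‖z‖ ≤ b} :=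
  fun _ hz => ⟨hz.1.le, hz.2.le⟩

theorem integrableOn_annulus {a b : ℝ} {h : ℂ → ℝ}
    (hc : ContinuousOn h {z | a ≤ ‖z‖ ∧ ‖z‖ ≤ b}) : IntegrableOn h (annulus a b) :=
  (hc.integrableOn_compact (isCompact_closedAnnulus a b)).mono_set
    (annulus_subset_closedAnnulus a b)

/-- Integration over an annulus in polar coordinates. -/
theorem setIntegral_annulus {a b : ℝ} (ha : 0 < a) {h : ℂ → ℝ}
    (hc : ContinuousOn h {z | a ≤ ‖z‖ ∧ ‖z‖ ≤ b}) :
    ∫ z in annulus a b, h z = ∫ r in Set.Ioo a b, r * (2 * π * circleAverage h 0 r) := by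
  rw [← integral_indicator (isOpen_annulus a b).measurableSet,
    ← Complex.integral_comp_polarCoord_symm]
  have hsub : Set.Ioo a b ×ˢ Set.Ioo (-π) π ⊆ Complex.polarCoord.target := by
    rw [Complex.polarCoord_target]
    exact Set.prod_mono (fun r hr => ha.trans hr.1) subset_rfl
  have hmeas : MeasurableSet (Set.Ioo a b ×ˢ Set.Ioo (-π) π) :=
    measurableSet_Ioo.prod measurableSet_Ioo
  have h1 : ∫ p in polarCoord.target,
        p.1 • (annulus a b).indicator h (Complex.polarCoord.symm p) =
      ∫ p in Set.Ioo a b ×ˢ Set.Ioo (-π) π, p.1 * h (Complex.polarCoord.symm p) := by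
    rw [← Set.inter_eq_self_of_subset_right hsub, ← setIntegral_indicator hmeas]
    refine setIntegral_congr_fun polarCoord.open_target.measurableSet fun p hp => ?_
    have hp' : p.1 ∈ Set.Ioi (0 : ℝ) ∧ p.2 ∈ Set.Ioo (-π) π := hp
    have hn : ‖Complex.polarCoord.symm p‖ = p.1 := by
      rw [Complex.norm_polarCoord_symm, abs_of_pos hp'.1]
    by_cases hpa : p.1 ∈ Set.Ioo a b
    · have hm : Complex.polarCoord.symm p ∈ annulus a b := by
        rw [annulus, Set.mem_ofPred_eq, hn]; exact hpa
      rw [Set.indicator_of_mem (show p ∈ Set.Ioo a b ×ˢ Set.Ioo (-π) π from ⟨hpa, hp'.2⟩)]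
      simp only [Set.indicator_of_mem hm, smul_eq_mul]
    · have hm : Complex.polarCoord.symm p ∉ annulus a b := by
        rw [annulus, Set.mem_ofPred_eq, hn]; exact hpa
      rw [Set.indicator_of_notMem (show p ∉ Set.Ioo a b ×ˢ Set.Ioo (-π) π from fun h => hpa h.1)]
      simp only [Set.indicator_of_notMem hm, smul_zero]
  have hint : IntegrableOn (fun p : ℝ × ℝ => p.1 * h (Complex.polarCoord.symm p))
      (Set.Ioo a b ×ˢ Set.Ioo (-π) π) := by
    refine IntegrableOn.mono_set (t := Set.Icc a b ×ˢ Set.Icc (-π) π) ?_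
      (Set.prod_mono Set.Ioo_subset_Icc_self Set.Ioo_subset_Icc_self)
    refine ContinuousOn.integrableOn_compact (isCompact_Icc.prod isCompact_Icc) ?_
    refine continuousOn_fst.mul (hc.comp ?_ ?_)
    · have e : (Complex.polarCoord.symm : ℝ × ℝ → ℂ) =
          fun p => p.1 * (Real.cos p.2 + Real.sin p.2 * Complex.I) :=
        funext Complex.polarCoord_symm_apply
      rw [e]
      fun_prop
    · intro p hp
      rw [Set.mem_ofPred_eq, Complex.norm_polarCoord_symm, abs_of_pos (ha.trans_le hp.1.1)]
      exact hp.1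
  refine h1.trans ?_
  rw [Measure.volume_eq_prod, setIntegral_prod _ hint]
  refine setIntegral_congr_fun measurableSet_Ioo fun r hr => ?_
  simp only
  rw [integral_const_mul, Real.circleAverage_eq_integral_add (-π), smul_eq_mul,
    mul_inv_cancel_left₀ (by positivity), ← integral_Ioc_eq_integral_Ioo,
    ← intervalIntegral.integral_of_le (by linarith [Real.pi_pos])]
  congr 1
  rw [intervalIntegral.integral_comp_add_right (fun θ => h (circleMap 0 r θ))]
  have e1 : 0 + -π = -π := by ring
  have e2 : 2 * π + -π = π := by ring
  rw [e1, e2]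
  refine intervalIntegral.integral_congr fun θ _ => ?_
  simp only [Complex.polarCoord_symm_apply, circleMap, zero_add, Complex.exp_mul_I,
    Complex.ofReal_cos, Complex.ofReal_sin]

theorem setIntegral_annulus_inv_norm_sq {a b : ℝ} (ha : 0 < a) (hab : a ≤ b) :
    ∫ z in annulus a b, (‖z‖ ^ 2)⁻¹ = 2 * π * log (b / a) := by
  rw [setIntegral_annulus ha]
  · have h1 : ∀ r ∈ Set.Ioo a b,
        r * (2 * π * circleAverage (fun z : ℂ => (‖z‖ ^ 2)⁻¹) 0 r) = 2 * π * r⁻¹ := by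
      intro r hr
      have hr0 : 0 < r := ha.trans hr.1
      rw [circleAverage_const_on_circle (a := (r ^ 2)⁻¹)]
      · field_simp
      · intro z hz
        rw [mem_sphere_zero_iff_norm, abs_of_pos hr0] at hz
        rw [hz]
    rw [setIntegral_congr_fun measurableSet_Ioo h1, integral_const_mul,
      ← integral_Ioc_eq_integral_Ioo, ← intervalIntegral.integral_of_le hab,
      integral_inv_of_pos ha (ha.trans_le hab)]
  · refine ContinuousOn.inv₀ (by fun_prop) fun z hz => ?_
    have := ha.trans_le hz.1
    positivity

theorem setIntegral_annulus_re_div_norm_sq {a b : ℝ} (ha : 0 < a) (hb : b < 1) {q : ℂ → ℂ}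
    (hq : DifferentiableOn ℂ q (Metric.ball 0 1)) (hq0 : q 0 = 0) :
    ∫ z in annulus a b, (q z).re * (‖z‖ ^ 2)⁻¹ = 0 := by
  rw [setIntegral_annulus ha]
  · rw [setIntegral_congr_fun measurableSet_Ioo (g := fun _ => (0 : ℝ)), integral_zero]
    intro r hr
    have hr0 : 0 < r := ha.trans hr.1
    have hsub : Metric.closedBall (0 : ℂ) |r| ⊆ Metric.ball 0 1 := by
      rw [abs_of_pos hr0]
      exact Metric.closedBall_subset_ball (hr.2.trans hb)
    have h1 : circleAverage q 0 r = 0 := by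
      rw [DiffContOnCl.circleAverage, hq0]
      refine DifferentiableOn.diffContOnCl (hq.mono ?_)
      exact (Metric.closure_ball_subset_closedBall).trans hsub
    have hci : CircleIntegrable q 0 r := by
      refine ContinuousOn.circleIntegrable' (hq.continuousOn.mono ?_)
      exact Metric.sphere_subset_closedBall.trans hsub
    have h2 : circleAverage (fun z => (q z).re) 0 r = 0 := by
      have := Complex.reCLM.circleAverage_comp_comm hci
      rw [h1, map_zero] at this
      exact this
    have h3 : circleAverage (fun z => (q z).re * (‖z‖ ^ 2)⁻¹) 0 r
        = circleAverage (fun z => (r ^ 2)⁻¹ • (q z).re) 0 r := by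
      refine circleAverage_congr_sphere fun z hz => ?_
      rw [mem_sphere_zero_iff_norm, abs_of_pos hr0] at hz
      simp only [hz, smul_eq_mul]
      ring
    simp only [h3, circleAverage_fun_smul, h2, smul_zero, mul_zero]
  · refine ContinuousOn.mul (Complex.continuous_re.comp_continuousOn
      (hq.continuousOn.mono fun z hz => ?_)) (ContinuousOn.inv₀ (by fun_prop) fun z hz => ?_)
    · rw [mem_ball_zero_iff]; exact hz.2.trans_lt hb
    · have := ha.trans_le hz.1
      positivity

theorem isOpen_image_of_injOn_ball {G : ℂ → ℂ} (hG : DifferentiableOn ℂ G (Metric.ball 0 1))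
    (hinj : Set.InjOn G (Metric.ball 0 1)) {s : Set ℂ} (hs : s ⊆ Metric.ball 0 1)
    (hso : IsOpen s) : IsOpen (G '' s) := by
  have han : AnalyticOnNhd ℂ G (Metric.ball 0 1) := hG.analyticOnNhd Metric.isOpen_ball
  rcases han.is_constant_or_isOpen (convex_ball (0 : ℂ) 1).isPreconnected with ⟨w, hw⟩ | h
  · have h0 : (0 : ℂ) ∈ Metric.ball (0 : ℂ) 1 := by simp
    have h1 : (1 / 2 : ℂ) ∈ Metric.ball (0 : ℂ) 1 := by
      rw [mem_ball_zero_iff]; norm_num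
    have := hinj h0 h1 ((hw _ h0).trans (hw _ h1).symm)
    norm_num at this
  · exact h s hs hso

theorem ball_subset_image_ball {G : ℂ → ℂ} (hG : DifferentiableOn ℂ G (Metric.ball 0 1))
    (hinj : Set.InjOn G (Metric.ball 0 1)) (hG0 : G 0 = 0) {ρ m : ℝ} (hρ0 : 0 < ρ) (hρ : ρ < 1)
    (hm : ∀ z, ‖z‖ = ρ → m ≤ ‖G z‖) : Metric.ball 0 m ⊆ G '' Metric.ball 0 ρ := by
  rcases le_or_gt m 0 with hm0 | hm0
  · rw [Metric.ball_eq_empty.2 hm0]; exact Set.empty_subset _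
  have hsub : Metric.closedBall (0 : ℂ) ρ ⊆ Metric.ball 0 1 := Metric.closedBall_subset_ball hρ
  have hcl : IsClosed (G '' Metric.closedBall 0 ρ) :=
    ((isCompact_closedBall (0 : ℂ) ρ).image_of_continuousOn
      (hG.continuousOn.mono hsub)).isClosed
  refine IsPreconnected.subset_left_of_subset_union (v := (G '' Metric.closedBall 0 ρ)ᶜ)
    (isOpen_image_of_injOn_ball hG hinj (Metric.ball_subset_closedBall.trans hsub)
      Metric.isOpen_ball) hcl.isOpen_compl
    (Set.disjoint_compl_right_iff_subset.2 (Set.image_mono Metric.ball_subset_closedBall))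
    ?_ ⟨0, by simpa using hm0, 0, by simpa using hρ0, hG0⟩
    (convex_ball (0 : ℂ) m).isPreconnected
  intro w hw
  by_contra hcon
  rw [Set.mem_union, not_or, Set.mem_compl_iff, not_not] at hcon
  obtain ⟨h1, z, hz, rfl⟩ := hcon
  have hz' : ‖z‖ ≤ ρ := by simpa using hz
  rcases hz'.lt_or_eq with h | h
  · exact h1 ⟨z, by simpa using h, rfl⟩
  · have := hm z h
    rw [mem_ball_zero_iff] at hw
    linarith

theorem setIntegral_image_inv_norm_sq {A : Set ℂ} (hA : IsOpen A) {f : ℂ → ℂ}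
    (hf : DifferentiableOn ℂ f A) (hinj : Set.InjOn f A) :
    ∫ w in f '' A, (‖w‖ ^ 2)⁻¹ = ∫ z in A, ‖deriv f z / f z‖ ^ 2 := by
  rw [integral_image_eq_integral_abs_det_fderiv_smul volume hA.measurableSet
    (f' := fun z => (fderiv ℂ f z).restrictScalars ℝ) (fun z hz =>
      ((hf.differentiableAt (hA.mem_nhds hz)).hasFDerivAt.restrictScalars ℝ).hasFDerivWithinAt)
    hinj]
  refine setIntegral_congr_fun hA.measurableSet fun z hz => ?_
  have hdet : ((fderiv ℂ f z).restrictScalars ℝ).det = ‖deriv f z‖ ^ 2 := by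
    have h1 : ((fderiv ℂ f z).restrictScalars ℝ).det =
        LinearMap.det (((fderiv ℂ f z : ℂ →L[ℂ] ℂ) : ℂ →ₗ[ℂ] ℂ).restrictScalars ℝ) := rfl
    rw [h1, LinearMap.det_restrictScalars, Algebra.norm_complex_apply, Complex.normSq_eq_norm_sq,
      LinearMap.det_ring]
    simp
  simp only [hdet, smul_eq_mul, abs_of_nonneg (sq_nonneg ‖deriv f z‖), norm_div, div_pow]
  rw [div_eq_mul_inv]

/-- A univalent function on the disc whose image is disjoint from its reflection `w ↦ 1 / w`
has derivative at most `1` at the origin. -/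
theorem norm_deriv_le_one_of_mul_ne_one {G : ℂ → ℂ}
    (hG : DifferentiableOn ℂ G (Metric.ball 0 1)) (hinj : Set.InjOn G (Metric.ball 0 1))
    (hG0 : G 0 = 0)
    (hmul : ∀ z ∈ Metric.ball (0 : ℂ) 1, ∀ w ∈ Metric.ball (0 : ℂ) 1, G z * G w ≠ 1) :
    ‖deriv G 0‖ ≤ 1 := by
  by_contra! hc
  have hb0 : (0 : ℂ) ∈ Metric.ball (0 : ℂ) 1 := by simp
  have hnhds : Metric.ball (0 : ℂ) 1 ∈ nhds (0 : ℂ) := Metric.ball_mem_nhds 0 one_pos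
  set h := dslope G 0 with hh
  have hhd : DifferentiableOn ℂ h (Metric.ball 0 1) := (Complex.differentiableOn_dslope hnhds).2 hG
  have hh0 : h 0 = deriv G 0 := dslope_same G 0
  have hGh : ∀ z, G z = z * h z := fun z => by
    have := sub_smul_dslope G 0 z
    rw [hG0, sub_zero, sub_zero, smul_eq_mul] at this
    exact this.symm
  have hhne : ∀ z ∈ Metric.ball (0 : ℂ) 1, h z ≠ 0 := by
    intro z hz hz0
    rcases eq_or_ne z 0 with rfl | hne
    · rw [hh0] at hz0
      rw [hz0, norm_zero] at hc
      linarith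
    · exact hne (hinj hz hb0 (by rw [hGh z, hz0, mul_zero, hG0]))
  obtain ⟨c, hc1, hcG⟩ := exists_between hc
  obtain ⟨ε, hε0, hε⟩ : ∃ ε > 0, ∀ z : ℂ, ‖z‖ < ε → c < ‖h z‖ := by
    have hcont : ContinuousAt (fun z => ‖h z‖) 0 :=
      ((hhd.differentiableAt hnhds).continuousAt).norm
    have hev : ∀ᶠ z in nhds (0 : ℂ), c < ‖h z‖ :=
      hcont.eventually_const_lt (show c < ‖h 0‖ by rw [hh0]; exact hcG)
    obtain ⟨ε, hε0, hε⟩ := Metric.eventually_nhds_iff_ball.1 hev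
    exact ⟨ε, hε0, fun z hz => hε z (by simpa using hz)⟩
  obtain ⟨ρ, hρ0, hρlt⟩ := exists_between (lt_min hε0 one_pos)
  have hρε : ρ < ε := hρlt.trans_le (min_le_left _ _)
  have hρ1 : ρ < 1 := hρlt.trans_le (min_le_right _ _)
  set m := c * ρ with hmdef
  have hm0 : 0 < m := by positivity
  have hm : ∀ z, ‖z‖ = ρ → m ≤ ‖G z‖ := fun z hz => by
    rw [hGh z, norm_mul, hz, mul_comm]
    exact mul_le_mul_of_nonneg_right (hε z (hz.trans_lt hρε)).le hρ0.le
  have hcinv : c⁻¹ < 1 := inv_lt_one_of_one_lt₀ hc1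
  obtain ⟨R, hRmax, hR1⟩ := exists_between (max_lt hρ1 hcinv)
  have hρR : ρ < R := (le_max_left _ _).trans_lt hRmax
  have hR0 : 0 < R := hρ0.trans hρR
  have hmR : ρ / R < m := by
    have : R⁻¹ < c := by
      rw [inv_lt_comm₀ hR0 (by linarith)]
      exact (le_max_right _ _).trans_lt hRmax
    rw [div_eq_inv_mul]
    exact mul_lt_mul_of_pos_right this hρ0
  obtain ⟨m', hm'1, hm'2⟩ := exists_between hmR
  have hm'0 : 0 < m' := (div_pos hρ0 hR0).trans hm'1
  have hsubA : annulus ρ R ⊆ Metric.ball 0 1 := fun z hz => by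
    rw [mem_ball_zero_iff]; exact hz.2.trans hR1
  have hball := ball_subset_image_ball hG hinj hG0 hρ0 hρ1 hm
  have hballsub : Metric.ball (0 : ℂ) ρ ⊆ Metric.ball 0 1 := Metric.ball_subset_ball hρ1.le
  have hlow : ∀ z ∈ annulus ρ R, m ≤ ‖G z‖ := by
    intro z hz
    by_contra! hlt
    obtain ⟨w, hw, hwz⟩ := hball (mem_ball_zero_iff.2 hlt)
    have hwe := hinj (hballsub hw) (hsubA hz) hwz
    rw [hwe, mem_ball_zero_iff] at hw
    linarith [hz.1]
  have hGne : ∀ z ∈ annulus ρ R, G z ≠ 0 := fun z hz h0 => by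
    have := hlow z hz
    rw [h0, norm_zero] at this
    linarith
  have hlow' : ∀ z ∈ annulus ρ R, m ≤ ‖(G z)⁻¹‖ := by
    intro z hz
    by_contra! hlt
    obtain ⟨w, hw, hwz⟩ := hball (mem_ball_zero_iff.2 hlt)
    exact hmul z (hsubA hz) w (hballsub hw) (by rw [hwz, mul_inv_cancel₀ (hGne z hz)])
  have hA : IsOpen (annulus ρ R) := isOpen_annulus ρ R
  have hGA : DifferentiableOn ℂ G (annulus ρ R) := hG.mono hsubA
  have hinjA : Set.InjOn G (annulus ρ R) := hinj.mono hsubA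
  have hIA : DifferentiableOn ℂ (fun z => (G z)⁻¹) (annulus ρ R) := hGA.inv hGne
  have hinjI : Set.InjOn (fun z => (G z)⁻¹) (annulus ρ R) := fun z hz w hw hzw =>
    hinjA hz hw (inv_injective hzw)
  have himg1 : G '' annulus ρ R ⊆ annulus m' m'⁻¹ := by
    rintro _ ⟨z, hz, rfl⟩
    refine ⟨hm'2.trans_le (hlow z hz), ?_⟩
    have := hm'2.trans_le (hlow' z hz)
    rw [norm_inv] at this
    exact (lt_inv_comm₀ hm'0 (norm_pos_iff.2 (hGne z hz))).1 this
  have himg2 : (fun z => (G z)⁻¹) '' annulus ρ R ⊆ annulus m' m'⁻¹ := by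
    rintro _ ⟨z, hz, rfl⟩
    refine ⟨hm'2.trans_le (hlow' z hz), ?_⟩
    simp only [norm_inv]
    exact inv_strictAnti₀ hm'0 (hm'2.trans_le (hlow z hz))
  have hdisj : Disjoint (G '' annulus ρ R) ((fun z => (G z)⁻¹) '' annulus ρ R) := by
    rw [Set.disjoint_left]
    rintro _ ⟨z, hz, rfl⟩ ⟨w, hw, hwz⟩
    refine hmul z (hsubA hz) w (hsubA hw) ?_
    rw [← hwz]
    exact inv_mul_cancel₀ (hGne w hw)
  have hm'lt : m' ≤ m'⁻¹ := by
    obtain ⟨r, hr1, hr2⟩ := exists_between hρR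
    have hrA : (r : ℂ) ∈ annulus ρ R := by
      have : ‖(r : ℂ)‖ = r := by
        rw [Complex.norm_real, Real.norm_of_nonneg (hρ0.trans hr1).le]
      exact ⟨by rw [this]; exact hr1, by rw [this]; exact hr2⟩
    have := himg1 ⟨_, hrA, rfl⟩
    exact (this.1.trans this.2).le
  have hIopen : IsOpen ((fun z => (G z)⁻¹) '' annulus ρ R) := by
    have himg : (fun z => (G z)⁻¹) '' annulus ρ R
        = {w | w ≠ 0} ∩ (fun w => w⁻¹) ⁻¹' (G '' annulus ρ R) := by
      ext w
      constructor
      · rintro ⟨z, hz, rfl⟩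
        exact ⟨inv_ne_zero (hGne z hz), z, hz, (inv_inv _).symm⟩
      · rintro ⟨-, z, hz, hzw⟩
        exact ⟨z, hz, by simp only [hzw, inv_inv]⟩
    rw [himg]
    exact ContinuousOn.isOpen_inter_preimage continuousOn_inv₀ isOpen_ne
      (isOpen_image_of_injOn_ball hG hinj hsubA hA)
  have hint : IntegrableOn (fun w : ℂ => (‖w‖ ^ 2)⁻¹) (annulus m' m'⁻¹) := by
    refine integrableOn_annulus (ContinuousOn.inv₀ (by fun_prop) fun z hz => ?_)
    have := hm'0.trans_le hz.1
    positivity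
  have hupper : 2 * ∫ z in annulus ρ R, ‖deriv G z / G z‖ ^ 2 ≤ 2 * π * log (m'⁻¹ / m') := by
    rw [← setIntegral_annulus_inv_norm_sq hm'0 hm'lt]
    have e1 := setIntegral_image_inv_norm_sq hA hGA hinjA
    have e2 : ∫ w in (fun z => (G z)⁻¹) '' annulus ρ R, (‖w‖ ^ 2)⁻¹
        = ∫ z in annulus ρ R, ‖deriv G z / G z‖ ^ 2 := by
      rw [setIntegral_image_inv_norm_sq hA hIA hinjI]
      refine setIntegral_congr_fun hA.measurableSet fun z hz => ?_
      have hd := ((hGA.differentiableAt (hA.mem_nhds hz)).hasDerivAt.fun_inv (hGne z hz)).deriv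
      simp only [hd]
      congr 1
      have := hGne z hz
      rw [show -deriv G z / G z ^ 2 / (G z)⁻¹ = -(deriv G z / G z) by field_simp, norm_neg]
    rw [two_mul]
    nth_rewrite 1 [← e1]
    rw [← e2, ← setIntegral_union hdisj hIopen.measurableSet (hint.mono_set himg1)
      (hint.mono_set himg2)]
    refine setIntegral_mono_set hint ?_ (Set.union_subset himg1 himg2).eventuallyLE
    exact Filter.Eventually.of_forall fun w => by positivity
  have hG'd : DifferentiableOn ℂ (deriv G) (Metric.ball 0 1) := hG.deriv Metric.isOpen_ball
  set q : ℂ → ℂ := fun z => deriv G z / h z - 1 with hq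
  have hqd : DifferentiableOn ℂ q (Metric.ball 0 1) := (hG'd.div hhd hhne).sub_const 1
  have hq0 : q 0 = 0 := by
    simp only [hq]
    rw [← hh0, div_self (hhne 0 hb0), sub_self]
  have hclsub : {z : ℂ | ρ ≤ ‖z‖ ∧ ‖z‖ ≤ R} ⊆ Metric.ball 0 1 := fun z hz => by
    rw [mem_ball_zero_iff]; exact hz.2.trans_lt hR1
  have hinvc : ContinuousOn (fun z : ℂ => (‖z‖ ^ 2)⁻¹) {z : ℂ | ρ ≤ ‖z‖ ∧ ‖z‖ ≤ R} := by
    refine ContinuousOn.inv₀ (by fun_prop) fun z hz => ?_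
    have := hρ0.trans_le hz.1
    positivity
  have hqc : ContinuousOn (fun z : ℂ => (q z).re * (‖z‖ ^ 2)⁻¹)
      {z : ℂ | ρ ≤ ‖z‖ ∧ ‖z‖ ≤ R} :=
    (Complex.continuous_re.comp_continuousOn (hqd.continuousOn.mono hclsub)).mul hinvc
  have hlower : 2 * π * log (R / ρ) ≤ ∫ z in annulus ρ R, ‖deriv G z / G z‖ ^ 2 := by
    have e : 2 * π * log (R / ρ) =
        ∫ z in annulus ρ R, ((‖z‖ ^ 2)⁻¹ + 2 * ((q z).re * (‖z‖ ^ 2)⁻¹)) := by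
      rw [integral_add (integrableOn_annulus hinvc) ((integrableOn_annulus hqc).const_mul 2),
        integral_const_mul, setIntegral_annulus_inv_norm_sq hρ0 hρR.le,
        setIntegral_annulus_re_div_norm_sq hρ0 hR1 hqd hq0]
      ring
    rw [e]
    refine setIntegral_mono_on
      ((integrableOn_annulus hinvc).add ((integrableOn_annulus hqc).const_mul 2))
      (integrableOn_annulus ?_) hA.measurableSet fun z hz => ?_
    · refine (((hG'd.continuousOn.mono hclsub).div (hG.continuousOn.mono hclsub) ?_).norm).pow 2
      intro z hz
      rw [hGh z]
      refine mul_ne_zero (fun h0 => ?_) (hhne z (hclsub hz))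
      have := hz.1
      rw [h0, norm_zero] at this
      linarith
    · have hz0 : z ≠ 0 := fun h0 => by
        have := hz.1
        rw [h0, norm_zero] at this
        linarith
      have hhz := hhne z (hsubA hz)
      have e3 : deriv G z / G z = (q z + 1) / z := by
        simp only [hq]
        rw [hGh z]
        field_simp
        ring
      rw [e3, norm_div, div_pow, div_eq_mul_inv]
      have hpos : 0 ≤ (‖z‖ ^ 2)⁻¹ := by positivity
      have : 1 + 2 * (q z).re ≤ ‖q z + 1‖ ^ 2 := by
        rw [← Complex.normSq_eq_norm_sq, Complex.normSq_apply]
        simp only [Complex.add_re, Complex.add_im, Complex.one_re, Complex.one_im]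
        nlinarith [sq_nonneg (q z).re, sq_nonneg (q z).im]
      calc (‖z‖ ^ 2)⁻¹ + 2 * ((q z).re * (‖z‖ ^ 2)⁻¹) = (1 + 2 * (q z).re) * (‖z‖ ^ 2)⁻¹ := by ring
        _ ≤ _ := mul_le_mul_of_nonneg_right this hpos
  have hlog : log (m'⁻¹ / m') = 2 * log m'⁻¹ := by
    rw [div_eq_mul_inv, Real.log_mul (by positivity) (by positivity)]
    ring
  have hfin : log (R / ρ) ≤ log m'⁻¹ := by
    have h2 : 2 * (2 * π * log (R / ρ)) ≤ 2 * (2 * π * log m'⁻¹) := by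
      rw [hlog] at hupper
      linarith
    have h3 : (0 : ℝ) < 2 * (2 * π) := by positivity
    nlinarith
  rw [Real.log_le_log_iff (by positivity) (by positivity), le_inv_comm₀ (by positivity) hm'0,
    inv_div] at hfin
  linarith

theorem isSimplyConnected_of_starConvex {E : Type*} [AddCommGroup E] [Module ℝ E]
    [TopologicalSpace E] [ContinuousAdd E] [ContinuousSMul ℝ E] {s : Set E} {x : E}
    (h : StarConvex ℝ x s) (hs : s.Nonempty) : IsSimplyConnected s := by
  have := h.contractibleSpace hs
  exact (inferInstance : SimplyConnectedSpace s)

/-- The Koebe one-quarter theorem. -/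
theorem norm_deriv_le_four_mul_of_injOn {f : ℂ → ℂ} {a : ℂ}
    (hf : DifferentiableOn ℂ f (Metric.ball 0 1)) (hinj : Set.InjOn f (Metric.ball 0 1))
    (ha : a ∉ f '' Metric.ball 0 1) : ‖deriv f 0‖ ≤ 4 * ‖f 0 - a‖ := by
  have hb0 : (0 : ℂ) ∈ Metric.ball (0 : ℂ) 1 := by simp
  have hne : ∀ z ∈ Metric.ball (0 : ℂ) 1, f z - a ≠ 0 := fun z hz h =>
    ha ⟨z, hz, sub_eq_zero.1 h⟩
  have h0 := hne 0 hb0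
  have hsc : IsSimplyConnected (Metric.ball (0 : ℂ) 1) :=
    isSimplyConnected_of_starConvex ((convex_ball (0 : ℂ) 1).starConvex hb0) ⟨0, hb0⟩
  obtain ⟨k, hkd, hk⟩ := exists_differentiableOn_sq_eq (g := fun z => (f z - a) / (f 0 - a))
    Metric.isOpen_ball hsc ((hf.sub_const a).div_const _) fun z hz => div_ne_zero (hne z hz) h0
  have hk0 : k 0 ^ 2 = 1 := by rw [hk 0 hb0, div_self h0]
  set F : ℂ → ℂ := fun z => k 0 * k z with hFdef
  have hFd : DifferentiableOn ℂ F (Metric.ball 0 1) := hkd.const_mul _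
  have hF : ∀ z ∈ Metric.ball (0 : ℂ) 1, F z ^ 2 = (f z - a) / (f 0 - a) := fun z hz => by
    simp only [hFdef, mul_pow, hk0, one_mul, hk z hz]
  have hF0 : F 0 = 1 := by simp only [hFdef, ← sq, hk0]
  have hFinj : ∀ z ∈ Metric.ball (0 : ℂ) 1, ∀ w ∈ Metric.ball (0 : ℂ) 1,
      F z ^ 2 = F w ^ 2 → z = w := fun z hz w hw h => by
    rw [hF z hz, hF w hw, div_left_inj' h0, sub_left_inj] at h
    exact hinj hz hw h
  have hFne : ∀ z ∈ Metric.ball (0 : ℂ) 1, F z ≠ 0 := fun z hz h => by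
    have := hF z hz
    rw [h, zero_pow two_ne_zero] at this
    exact div_ne_zero (hne z hz) h0 this.symm
  have hsum : ∀ z ∈ Metric.ball (0 : ℂ) 1, ∀ w ∈ Metric.ball (0 : ℂ) 1, F z + F w ≠ 0 := by
    intro z hz w hw h
    have h1 : F z = -F w := eq_neg_of_add_eq_zero_left h
    obtain rfl := hFinj z hz w hw (by rw [h1, neg_sq])
    exact hFne z hz (by linear_combination h / 2)
  have hF1 : ∀ z ∈ Metric.ball (0 : ℂ) 1, F z + 1 ≠ 0 := fun z hz => by
    rw [← hF0]; exact hsum z hz 0 hb0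
  set G : ℂ → ℂ := fun z => (F z - 1) / (F z + 1) with hG
  have hGd : DifferentiableOn ℂ G (Metric.ball 0 1) :=
    (hFd.sub_const 1).div (hFd.add_const 1) hF1
  have key : ‖deriv G 0‖ ≤ 1 := by
    refine norm_deriv_le_one_of_mul_ne_one hGd ?_ ?_ ?_
    · intro z hz w hw h
      simp only [hG] at h
      rw [div_eq_div_iff (hF1 z hz) (hF1 w hw)] at h
      refine hFinj z hz w hw ?_
      have : F z = F w := by linear_combination h / 2
      rw [this]
    · simp only [hG, hF0, sub_self, zero_div]
    · intro z hz w hw h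
      simp only [hG] at h
      rw [div_mul_div_comm, div_eq_one_iff_eq (mul_ne_zero (hF1 z hz) (hF1 w hw))] at h
      exact hsum z hz w hw (by linear_combination -h / 2)
  have hfd : HasDerivAt f (deriv f 0) 0 :=
    (hf.differentiableAt (Metric.isOpen_ball.mem_nhds hb0)).hasDerivAt
  have hFd0 : HasDerivAt F (deriv F 0) 0 :=
    (hFd.differentiableAt (Metric.isOpen_ball.mem_nhds hb0)).hasDerivAt
  have hF' := hasDerivAt_of_sq_eq Metric.isOpen_ball hFd hF hb0
    ((hfd.sub_const a).div_const (f 0 - a))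
  have hG' : deriv G 0 = deriv f 0 / (4 * (f 0 - a)) := by
    have h := ((hFd0.sub_const 1).fun_div (hFd0.add_const 1) (hF1 0 hb0)).deriv
    rw [hF0, mul_one] at hF'
    change deriv G 0 = _ at h
    rw [h, hF0, mul_comm 4 (f 0 - a), ← div_div, ← hF']
    ring
  rw [hG', norm_div, norm_mul, div_le_one
    (by rw [← norm_mul]; exact norm_pos_iff.2 (mul_ne_zero (by norm_num) h0))] at key
  simpa using key

theorem hasDerivAt_invFunOn {V : Set ℂ} {p : ℂ → ℂ} (hV : IsOpen V)
    (hp : DifferentiableOn ℂ p V) (hinj : Set.InjOn p V) (hd : ∀ z ∈ V, deriv p z ≠ 0)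
    {z : ℂ} (hz : z ∈ V) :
    HasDerivAt (Function.invFunOn p V) (deriv p z)⁻¹ (p z) := by
  have hs : HasStrictDerivAt p (deriv p z) z :=
    (hp.analyticAt (hV.mem_nhds hz)).hasStrictDerivAt
  have hleft : Set.LeftInvOn (Function.invFunOn p V) p V := hinj.leftInvOn_invFunOn
  have hVn : p '' V ∈ nhds (p z) := by
    rw [← hs.map_nhds_eq (hd z hz)]
    exact Filter.image_mem_map (hV.mem_nhds hz)
  refine HasDerivAt.of_local_left_inverse ?_ (f := p) ?_ (hd z hz) ?_
  · rw [ContinuousAt, hleft hz]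
    intro N hN
    rw [Filter.mem_map, ← hs.map_nhds_eq (hd z hz), Filter.mem_map]
    filter_upwards [hN, hV.mem_nhds hz] with y hy hyV
    rw [Set.mem_preimage, Set.mem_preimage, hleft hyV]
    exact hy
  · rw [hleft hz]
    exact hs.hasDerivAt
  · filter_upwards [hVn] with y hy
    exact Function.invFunOn_eq hy

/-- The Koebe estimate for the hyperbolic density of a domain with Riemann map `p`. -/
theorem one_sub_norm_sq_le_of_bijOn_ball {V : Set ℂ} {p : ℂ → ℂ} (hV : IsOpen V)
    (hp : DifferentiableOn ℂ p V) (hinj : Set.InjOn p V) (hd : ∀ z ∈ V, deriv p z ≠ 0)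
    (himg : p '' V = Metric.ball 0 1) {z a : ℂ} (hz : z ∈ V) (ha : a ∉ V) :
    1 - ‖p z‖ ^ 2 ≤ 4 * (‖deriv p z‖ * ‖z - a‖) := by
  set f := Function.invFunOn p V with hf
  have hleft : Set.LeftInvOn f p V := hinj.leftInvOn_invFunOn
  have hmem : ∀ w ∈ Metric.ball (0 : ℂ) 1, f w ∈ V := fun w hw =>
    Function.invFunOn_mem (himg.symm ▸ hw : w ∈ p '' V)
  have hright : ∀ w ∈ Metric.ball (0 : ℂ) 1, p (f w) = w := fun w hw =>
    Function.invFunOn_eq (himg.symm ▸ hw : w ∈ p '' V)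
  have hfd : DifferentiableOn ℂ f (Metric.ball 0 1) := fun w hw => by
    have := hasDerivAt_invFunOn hV hp hinj hd (hmem w hw)
    rw [hright w hw] at this
    exact this.differentiableAt.differentiableWithinAt
  have hpz : p z ∈ Metric.ball (0 : ℂ) 1 := himg ▸ ⟨z, hz, rfl⟩
  have hb : ‖-p z‖ < 1 := by simpa using hpz
  have hb0 : (0 : ℂ) ∈ Metric.ball (0 : ℂ) 1 := by simp
  have hmaps : Set.MapsTo (discAut (-p z)) (Metric.ball 0 1) (Metric.ball 0 1) := fun w hw => by
    rw [mem_ball_zero_iff] at hw ⊢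
    exact norm_discAut_lt_one hb hw
  have hfinj : Set.InjOn f (Metric.ball 0 1) := fun w hw w' hw' h => by
    rw [← hright w hw, h, hright w' hw']
  have hzero : discAut (-p z) 0 = p z := by rw [discAut_zero, neg_neg]
  have hfz : f (discAut (-p z) 0) = z := by rw [hzero]; exact hleft hz
  have hder : HasDerivAt (f ∘ discAut (-p z)) ((deriv p z)⁻¹ * ((1 - ‖p z‖ ^ 2 : ℝ) : ℂ)) 0 := by
    have h1 := hasDerivAt_discAut (w := 0) hb (by simp)
    rw [norm_neg, mul_zero, sub_zero, one_pow, div_one] at h1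
    have h2 := hasDerivAt_invFunOn hV hp hinj hd hz
    rw [← hzero] at h2
    exact h2.comp 0 h1
  have hk := norm_deriv_le_four_mul_of_injOn (f := f ∘ discAut (-p z)) (a := a)
    (hfd.comp (fun w hw => (hasDerivAt_discAut hb
      (by simpa using hw)).differentiableAt.differentiableWithinAt) hmaps)
    (hfinj.comp (injOn_discAut hb) hmaps)
    (by rintro ⟨w, hw, rfl⟩; exact ha (hmem _ (hmaps hw)))
  have hpos : 0 < 1 - ‖p z‖ ^ 2 := by
    rw [norm_neg] at hb
    nlinarith [norm_nonneg (p z)]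
  rw [hder.deriv, norm_mul, norm_inv, Complex.norm_real, Real.norm_of_nonneg hpos.le,
    Function.comp_apply, hfz, inv_mul_le_iff₀ (norm_pos_iff.2 (hd z hz))] at hk
  linarith

theorem hasDerivAt_diskField {p : ℝ → ℂ} {r : ℝ → ℂ} {p' r' : ℂ} {t : ℝ} (hp : HasDerivAt p p' t)
    (hr : HasDerivAt r r' t) (h1 : 1 - ‖p t‖ ^ 2 ≠ 0) (T : ℂ →L[ℝ] ℝ) :
    HasDerivAt (fun t => T (p t * starRingEnd ℂ (r t)) / (1 - ‖p t‖ ^ 2))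
      ((T (p' * starRingEnd ℂ (r t) + p t * starRingEnd ℂ r') * (1 - ‖p t‖ ^ 2) +
        T (p t * starRingEnd ℂ (r t)) * (2 * (p' * starRingEnd ℂ (p t)).re)) /
          (1 - ‖p t‖ ^ 2) ^ 2) t := by
  have hs := (hp.norm_sq).const_sub 1
  have hm := T.hasFDerivAt.comp_hasDerivAt t (hp.mul hr.star)
  refine (hm.fun_div hs h1).congr_deriv ?_
  rw [Complex.inner]
  congr 1
  simp only [Function.comp_apply, Pi.mul_apply, starRingEnd_apply]
  ring

section diskField

variable {V : Set ℂ} {p : ℂ → ℂ}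

theorem contDiffAt_diskField (hV : IsOpen V) (hp : DifferentiableOn ℂ p V) (T : ℂ →L[ℝ] ℝ)
    {z : ℂ} (hz : z ∈ V) (h1 : ‖p z‖ < 1) :
    ContDiffAt ℝ 1 (fun z => T (p z * starRingEnd ℂ (deriv p z)) / (1 - ‖p z‖ ^ 2)) z := by
  have h2 : ContDiffAt ℝ 1 p z := (hp.analyticAt (hV.mem_nhds hz)).contDiffAt.restrict_scalars ℝ
  have h3 : ContDiffAt ℝ 1 (deriv p) z :=
    ((hp.deriv hV).analyticAt (hV.mem_nhds hz)).contDiffAt.restrict_scalars ℝ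
  have h4 : ContDiffAt ℝ 1 (fun z => starRingEnd ℂ (deriv p z)) z :=
    Complex.conjCLE.contDiff.contDiffAt.comp z h3
  have h5 : 1 - ‖p z‖ ^ 2 ≠ 0 := by nlinarith [norm_nonneg (p z)]
  exact (T.contDiff.contDiffAt.comp z (h2.mul h4)).div
    (contDiffAt_const.sub (h2.norm_sq ℝ)) h5

theorem fderiv_diskField_apply (hV : IsOpen V) (hp : DifferentiableOn ℂ p V) (T : ℂ →L[ℝ] ℝ)
    {z : ℂ} (hz : z ∈ V) (h1 : ‖p z‖ < 1) (v : ℂ) :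
    fderiv ℝ (fun z => T (p z * starRingEnd ℂ (deriv p z)) / (1 - ‖p z‖ ^ 2)) z v =
      (T (v * deriv p z * starRingEnd ℂ (deriv p z) +
          p z * starRingEnd ℂ (v * deriv (deriv p) z)) * (1 - ‖p z‖ ^ 2) +
        T (p z * starRingEnd ℂ (deriv p z)) * (2 * (v * deriv p z * starRingEnd ℂ (p z)).re)) /
          (1 - ‖p z‖ ^ 2) ^ 2 := by
  have h5 : 1 - ‖p z‖ ^ 2 ≠ 0 := by nlinarith [norm_nonneg (p z)]
  have hline : ∀ g : ℂ → ℂ, DifferentiableOn ℂ g V →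
      HasDerivAt (fun t : ℝ => g (z + t • v)) (v * deriv g z) 0 := by
    intro g hg
    have h := ((hg.differentiableAt (hV.mem_nhds hz)).hasFDerivAt.restrictScalars ℝ).hasLineDerivAt v
    refine HasDerivAt.congr_deriv h ?_
    rw [ContinuousLinearMap.coe_restrictScalars', fderiv_eq_smul_deriv, smul_eq_mul]
  have h2 := hasDerivAt_diskField (hline p hp) (hline (deriv p) (hp.deriv hV))
    (by simpa using h5) T
  have h3 := (((contDiffAt_diskField hV hp T hz h1).differentiableAt
    one_ne_zero).hasFDerivAt.hasLineDerivAt v)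
  have h4 := HasDerivAt.unique h3 h2
  simpa only [zero_smul, add_zero] using h4

theorem divergence_diskField (hV : IsOpen V) (hp : DifferentiableOn ℂ p V)
    {z : ℂ} (hz : z ∈ V) (h1 : ‖p z‖ < 1) :
    fderiv ℝ (fun z => Complex.reCLM (p z * starRingEnd ℂ (deriv p z)) / (1 - ‖p z‖ ^ 2)) z 1 +
    fderiv ℝ (fun z => Complex.imCLM (p z * starRingEnd ℂ (deriv p z)) / (1 - ‖p z‖ ^ 2)) z
      Complex.I = 2 * (‖deriv p z‖ ^ 2 / (1 - ‖p z‖ ^ 2) ^ 2) := by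
  have h5 : 1 - ‖p z‖ ^ 2 ≠ 0 := by nlinarith [norm_nonneg (p z)]
  rw [fderiv_diskField_apply hV hp _ hz h1, fderiv_diskField_apply hV hp _ hz h1, ← add_div,
    mul_div_assoc']
  congr 1
  simp only [← Complex.normSq_eq_norm_sq, Complex.normSq_apply, Complex.reCLM_apply,
    Complex.imCLM_apply, map_mul, Complex.mul_re, Complex.mul_im, Complex.add_re, Complex.add_im,
    Complex.conj_re, Complex.conj_im, Complex.I_re, Complex.I_im, Complex.one_re, Complex.one_im]
  ring

theorem norm_sq_diskField {a b : ℂ} (h1 : ‖a‖ < 1) :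
    (Complex.reCLM (a * starRingEnd ℂ b) / (1 - ‖a‖ ^ 2)) ^ 2 +
      (Complex.imCLM (a * starRingEnd ℂ b) / (1 - ‖a‖ ^ 2)) ^ 2 ≤
    ‖b‖ ^ 2 / (1 - ‖a‖ ^ 2) ^ 2 := by
  rw [div_pow, div_pow, ← add_div]
  have h2 : (Complex.reCLM (a * starRingEnd ℂ b)) ^ 2 + (Complex.imCLM (a * starRingEnd ℂ b)) ^ 2
      = ‖a‖ ^ 2 * ‖b‖ ^ 2 := by
    rw [← Complex.normSq_eq_norm_sq, ← Complex.normSq_eq_norm_sq, Complex.normSq_apply,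
      Complex.normSq_apply]
    simp only [Complex.reCLM_apply, Complex.imCLM_apply, Complex.mul_re, Complex.mul_im,
      Complex.conj_re, Complex.conj_im]
    ring
  rw [h2]
  gcongr
  have : ‖a‖ ^ 2 ≤ 1 := by nlinarith [norm_nonneg a]
  nlinarith [sq_nonneg ‖b‖]

end diskField

theorem sq_add_sq_le_norm_sq (L : ℂ →L[ℝ] ℝ) : L 1 ^ 2 + L Complex.I ^ 2 ≤ ‖L‖ ^ 2 := by
  set w : ℂ := ⟨L 1, L Complex.I⟩ with hw
  have h1 : L w = L 1 ^ 2 + L Complex.I ^ 2 := by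
    have : w = (L 1) • (1 : ℂ) + (L Complex.I) • Complex.I := by
      apply Complex.ext <;> simp [hw]
    rw [this, map_add, map_smul, map_smul, smul_eq_mul, smul_eq_mul]
    ring
  have h2 : ‖w‖ ^ 2 = L 1 ^ 2 + L Complex.I ^ 2 := by
    rw [← Complex.normSq_eq_norm_sq, Complex.normSq_apply]
    ring
  have h3 : L w ≤ ‖L‖ * ‖w‖ := (le_abs_self _).trans (L.le_opNorm w)
  rw [h1, ← h2] at h3
  rw [← h2]
  rcases (norm_nonneg w).eq_or_lt with h0 | h0
  · rw [← h0, zero_pow two_ne_zero]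
    positivity
  · have : ‖w‖ ≤ ‖L‖ := le_of_mul_le_mul_right (by rw [← sq]; exact h3) h0
    gcongr

theorem contDiff_sq_mul_of_tsupport_subset {V : Set ℂ} {u g : ℂ → ℝ} (hu : ContDiff ℝ 1 u)
    (hs : tsupport u ⊆ V) (hg : ∀ z ∈ V, ContDiffAt ℝ 1 g z) :
    ContDiff ℝ 1 (fun z => u z ^ 2 * g z) := by
  rw [contDiff_iff_contDiffAt]
  intro z
  by_cases hz : z ∈ V
  · exact (hu.contDiffAt.pow 2).mul (hg z hz)
  · refine contDiffAt_const (c := (0 : ℝ)) |>.congr_of_eventuallyEq ?_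
    filter_upwards [notMem_tsupport_iff_eventuallyEq.1 fun h => hz (hs h)] with y hy
    simp [hy]

theorem integral_fderiv_apply_eq_zero {g : ℂ → ℝ} (hg : ContDiff ℝ 1 g)
    (hc : HasCompactSupport g) (v : ℂ) :
    Integrable (fun z => fderiv ℝ g z v) ∧ ∫ z, fderiv ℝ g z v = 0 := by
  have hcont : Continuous fun z => fderiv ℝ g z v :=
    (hg.continuous_fderiv one_ne_zero).clm_apply continuous_const
  have hi : Integrable (fun z => fderiv ℝ g z v) :=
    hcont.integrable_of_hasCompactSupport (hc.fderiv_apply ℝ v)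
  refine ⟨hi, ?_⟩
  have := integral_mul_fderiv_eq_neg_fderiv_mul_of_integrable (μ := (volume : Measure ℂ))
    (f := fun _ => (1 : ℝ)) (g := g) (v := v) (by simp) (by simpa using hi)
    (by simpa using hg.continuous.integrable_of_hasCompactSupport hc)
    (fun _ _ => differentiableAt_const _)
    (fun z _ => hg.differentiable one_ne_zero z)
  simpa using this

/-- Hardy's inequality with hyperbolic weight on a conformal disc. -/
theorem integral_le_integral_norm_fderiv_sq {V : Set ℂ} {p : ℂ → ℂ} (hV : IsOpen V)
    (hp : DifferentiableOn ℂ p V) (hp1 : ∀ z ∈ V, ‖p z‖ < 1) {u Φ : ℂ → ℝ} (hu : ContDiff ℝ 1 u)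
    (hc : HasCompactSupport u) (hs : tsupport u ⊆ V) (hΦ0 : ∀ z, 0 ≤ Φ z)
    (hΦV : ∀ z ∈ V, Φ z ≤ u z ^ 2 * (‖deriv p z‖ ^ 2 / (1 - ‖p z‖ ^ 2) ^ 2))
    (hΦ : ∀ z ∉ V, Φ z = 0) :
    ∫ z, Φ z ≤ ∫ z, ‖fderiv ℝ u z‖ ^ 2 := by
  set α : ℂ → ℝ :=
    fun z => Complex.reCLM (p z * starRingEnd ℂ (deriv p z)) / (1 - ‖p z‖ ^ 2) with hα
  set β : ℂ → ℝ :=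
    fun z => Complex.imCLM (p z * starRingEnd ℂ (deriv p z)) / (1 - ‖p z‖ ^ 2) with hβ
  have hαc : ∀ z ∈ V, ContDiffAt ℝ 1 α z := fun z hz => contDiffAt_diskField hV hp _ hz (hp1 z hz)
  have hβc : ∀ z ∈ V, ContDiffAt ℝ 1 β z := fun z hz => contDiffAt_diskField hV hp _ hz (hp1 z hz)
  have hsupp : ∀ g : ℂ → ℝ, HasCompactSupport fun z => u z ^ 2 * g z := fun g =>
    hc.mono fun z hz hz0 => hz (by simp [hz0])
  obtain ⟨hi1, he1⟩ := integral_fderiv_apply_eq_zero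
    (contDiff_sq_mul_of_tsupport_subset hu hs hαc) (hsupp α) 1
  obtain ⟨hi2, he2⟩ := integral_fderiv_apply_eq_zero
    (contDiff_sq_mul_of_tsupport_subset hu hs hβc) (hsupp β) Complex.I
  have hi3 : Integrable fun z => ‖fderiv ℝ u z‖ ^ 2 :=
    ((hu.continuous_fderiv one_ne_zero).norm.pow 2).integrable_of_hasCompactSupport
      ((hc.fderiv ℝ).mono fun z hz hz0 => hz (by simp [hz0]))
  have hprod : ∀ g : ℂ → ℝ, ∀ z, DifferentiableAt ℝ g z → ∀ v,
      fderiv ℝ (fun z => u z ^ 2 * g z) z v =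
        2 * u z * fderiv ℝ u z v * g z + u z ^ 2 * fderiv ℝ g z v := by
    intro g z hg v
    have hd := ((hu.differentiable one_ne_zero z).hasFDerivAt.pow 2).fun_mul hg.hasFDerivAt
    rw [hd.fderiv]
    simp
    ring
  have hle : ∫ z, Φ z ≤ ∫ z, (‖fderiv ℝ u z‖ ^ 2 +
      (fderiv ℝ (fun z => u z ^ 2 * α z) z 1 +
        fderiv ℝ (fun z => u z ^ 2 * β z) z Complex.I)) := by
    refine integral_mono_of_nonneg (Filter.Eventually.of_forall hΦ0) (hi3.add (hi1.add hi2))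
      (Filter.Eventually.of_forall fun z => ?_)
    simp only
    by_cases hz : z ∈ V
    · rw [hprod α z ((hαc z hz).differentiableAt one_ne_zero),
        hprod β z ((hβc z hz).differentiableAt one_ne_zero)]
      refine (hΦV z hz).trans ?_
      have h1 := divergence_diskField hV hp hz (hp1 z hz)
      have h2 := norm_sq_diskField (b := deriv p z) (hp1 z hz)
      have h3 := sq_add_sq_le_norm_sq (fderiv ℝ u z)
      change fderiv ℝ α z 1 + fderiv ℝ β z Complex.I = _ at h1
      change α z ^ 2 + β z ^ 2 ≤ _ at h2
      have h4 := mul_le_mul_of_nonneg_left h2 (sq_nonneg (u z))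
      have h5 : u z ^ 2 * (fderiv ℝ α z 1 + fderiv ℝ β z Complex.I) =
        u z ^ 2 * (2 * (‖deriv p z‖ ^ 2 / (1 - ‖p z‖ ^ 2) ^ 2)) := by rw [h1]
      nlinarith [sq_nonneg (fderiv ℝ u z 1 + u z * α z),
        sq_nonneg (fderiv ℝ u z Complex.I + u z * β z)]
    · have hz0 : u =ᶠ[nhds z] 0 := notMem_tsupport_iff_eventuallyEq.1 fun h => hz (hs h)
      have hfd : ∀ g : ℂ → ℝ, fderiv ℝ (fun z => u z ^ 2 * g z) z = 0 := by
        intro g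
        have : (fun z => u z ^ 2 * g z) =ᶠ[nhds z] fun _ => (0 : ℝ) := by
          filter_upwards [hz0] with y hy
          simp [hy]
        rw [this.fderiv_eq, fderiv_fun_const]
        rfl
      rw [hfd α, hfd β, hΦ z hz]
      simp only [zero_apply, add_zero]
      positivity
  have hi12 : Integrable fun z => fderiv ℝ (fun z => u z ^ 2 * α z) z 1 +
      fderiv ℝ (fun z => u z ^ 2 * β z) z Complex.I := hi1.add hi2
  rw [integral_add hi3 hi12, integral_add hi1 hi2, he1, he2, add_zero, add_zero] at hle
  exact hle

/-- The Hardy inequality with constant `1 / 16` on simply connected open subsets of `ℂ`. -/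
theorem hardy_inequality_complex {U : Set ℂ} (hUo : IsOpen U) (hUc : IsSimplyConnected U)
    (hU : U ≠ Set.univ) {u : ℂ → ℝ} (hu : ContDiff ℝ 1 u) (hc : HasCompactSupport u)
    (hs : tsupport u ⊆ U) :
    1 / 16 * ∫ z in U, u z ^ 2 / Metric.infDist z Uᶜ ^ 2 ≤ ∫ z in U, ‖fderiv ℝ u z‖ ^ 2 := by
  obtain ⟨V, p, hVo, hKV, hVU, hp, hinj, hd, himg⟩ :=
    exists_conformal_disc_of_isCompact hUo hUc hU hc.isCompact hs
  have hu0 : ∀ z, z ∉ tsupport u → u z = 0 := fun z hz => image_eq_zero_of_notMem_tsupport hz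
  have hp1 : ∀ z ∈ V, ‖p z‖ < 1 := fun z hz => by
    have : p z ∈ Metric.ball (0 : ℂ) 1 := himg ▸ ⟨z, hz, rfl⟩
    simpa using this
  rw [setIntegral_eq_integral_of_forall_compl_eq_zero (fun z hz => by
      rw [hu0 z fun h => hz (hs h)]; simp),
    setIntegral_eq_integral_of_forall_compl_eq_zero (fun z hz => by
      rw [image_eq_zero_of_notMem_tsupport (f := fderiv ℝ u)
        fun h => hz (hs (tsupport_fderiv_subset ℝ h))]; simp), ← integral_const_mul]
  refine integral_le_integral_norm_fderiv_sq hVo hp hp1 hu hc hKV (fun z => by positivity) ?_ ?_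
  · intro z hz
    obtain ⟨a, ha, hda⟩ := hUo.isClosed_compl.exists_infDist_eq_dist
      (Set.nonempty_compl.2 hU) z
    have hza : 0 < ‖z - a‖ := by
      rw [norm_pos_iff, sub_ne_zero]
      rintro rfl
      exact ha (hVU hz)
    have hk := one_sub_norm_sq_le_of_bijOn_ball hVo hp hinj hd himg hz fun h => ha (hVU h)
    have hs0 : 0 < 1 - ‖p z‖ ^ 2 := by nlinarith [hp1 z hz, norm_nonneg (p z)]
    rw [hda, dist_eq_norm]
    have h1 : 1 / (4 * ‖z - a‖) ≤ ‖deriv p z‖ / (1 - ‖p z‖ ^ 2) := by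
      rw [div_le_div_iff₀ (by positivity) hs0]
      linarith
    have h2 : 1 / 16 * (u z ^ 2 / ‖z - a‖ ^ 2) = u z ^ 2 * (1 / (4 * ‖z - a‖)) ^ 2 := by
      field_simp
      ring
    rw [h2, ← div_pow]
    gcongr
  · intro z hz
    rw [hu0 z fun h => hz (hKV h)]
    simp

/-- The standard linear isometry between `ℂ` and the Euclidean plane. -/
noncomputable def complexPlaneEquiv : ℂ ≃ₗᵢ[ℝ] EuclideanSpace ℝ (Fin 2) :=
  Complex.orthonormalBasisOneI.repr

/-- The Hardy inequality with constant `1 / 16` on simply connected planar domains. -/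
theorem hardy_inequality_plane {Ω : Set (EuclideanSpace ℝ (Fin 2))} (hΩo : IsOpen Ω)
    (hΩc : IsSimplyConnected Ω) (hΩ : Ω ≠ Set.univ) {u : EuclideanSpace ℝ (Fin 2) → ℝ}
    (hu : ContDiff ℝ 1 u) (hc : HasCompactSupport u) (hs : tsupport u ⊆ Ω) :
    1 / 16 * ∫ x in Ω, u x ^ 2 / Metric.infDist x Ωᶜ ^ 2 ≤ ∫ x in Ω, ‖gradient u x‖ ^ 2 := by
  set e := complexPlaneEquiv with he
  have hmp : MeasurePreserving e := e.measurePreserving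
  have hme : MeasurableEmbedding e := e.toHomeomorph.measurableEmbedding
  have himg : e '' (e ⁻¹' Ω)ᶜ = Ωᶜ := by
    rw [← Set.preimage_compl, Set.image_preimage_eq _ e.surjective]
  have key := hardy_inequality_complex (U := e ⁻¹' Ω) (u := u ∘ e)
    (hΩo.preimage e.continuous) ((e.toHomeomorph.isSimplyConnected_preimage).2 hΩc)
    (fun h => hΩ (e.surjective.preimage_injective h))
    (hu.comp e.contDiff) (hc.comp_homeomorph e.toHomeomorph)
    (by
      have h := tsupport_comp_eq_preimage u e.toHomeomorph
      change tsupport (u ∘ e) = e ⁻¹' tsupport u at h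
      rw [h]
      exact Set.preimage_mono hs)
  have hd : ∀ z, Metric.infDist (e z) Ωᶜ = Metric.infDist z (e ⁻¹' Ω)ᶜ := fun z => by
    rw [← himg, Metric.infDist_image e.isometry]
  have hg : ∀ z, ‖gradient u (e z)‖ = ‖fderiv ℝ (u ∘ e) z‖ := fun z => by
    have h : fderiv ℝ (u ∘ e) z = (fderiv ℝ u (e z)).comp (e : ℂ →L[ℝ] _) :=
      e.toContinuousLinearEquiv.comp_right_fderiv
    rw [h, ContinuousLinearMap.opNorm_comp_linearIsometryEquiv]
    exact LinearIsometryEquiv.norm_map _ _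
  have h1 : ∫ x in Ω, u x ^ 2 / Metric.infDist x Ωᶜ ^ 2 =
      ∫ z in e ⁻¹' Ω, (u ∘ e) z ^ 2 / Metric.infDist z (e ⁻¹' Ω)ᶜ ^ 2 := by
    refine (hmp.setIntegral_preimage_emb hme _ _).symm.trans ?_
    simp only [hd]
    rfl
  have h2 : ∫ x in Ω, ‖gradient u x‖ ^ 2 = ∫ z in e ⁻¹' Ω, ‖fderiv ℝ (u ∘ e) z‖ ^ 2 := by
    refine (hmp.setIntegral_preimage_emb hme _ _).symm.trans ?_
    simp only [hg]
  rw [h1, h2]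
  exact key

/-- The test constants in the definition of the Hardy constant are bounded above. -/
theorem bddAbove_hardyConst_set {n : ℕ} {Ω : Set (EuclideanSpace ℝ (Fin n))} (hΩo : IsOpen Ω)
    (hΩn : Ω.Nonempty) (hΩ : Ω ≠ Set.univ) :
    BddAbove {c : ℝ | 0 ≤ c ∧ ∀ u : EuclideanSpace ℝ (Fin n) → ℝ,
      ContDiff ℝ (⊤ : ℕ∞) u → HasCompactSupport u → tsupport u ⊆ Ω →
      c * ∫ x in Ω, u x ^ 2 / Metric.infDist x Ωᶜ ^ 2 ≤ ∫ x in Ω, ‖gradient u x‖ ^ 2} := by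
  obtain ⟨x₀, hx₀⟩ := hΩn
  obtain ⟨r, hr, hrΩ⟩ := Metric.nhds_basis_closedBall.mem_iff.1 (hΩo.mem_nhds hx₀)
  let b : ContDiffBump x₀ := ⟨r / 2, r, by positivity, by linarith⟩
  have hbs : tsupport b ⊆ Ω := by rw [b.tsupport_eq]; exact hrΩ
  have hdpos : ∀ x ∈ Ω, Metric.infDist x Ωᶜ ≠ 0 := fun x hx =>
    ((hΩo.isClosed_compl.notMem_iff_infDist_pos (Set.nonempty_compl.2 hΩ)).1
      fun h => h hx).ne'
  have hb0 : ∀ x, x ∉ Ω → b x = 0 := fun x hx =>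
    image_eq_zero_of_notMem_tsupport fun h => hx (hbs h)
  have hcs : HasCompactSupport fun x => b x ^ 2 / Metric.infDist x Ωᶜ ^ 2 :=
    b.hasCompactSupport.mono fun x hx h0 => hx (by simp [h0])
  have hcont : Continuous fun x => b x ^ 2 / Metric.infDist x Ωᶜ ^ 2 := by
    refine continuous_of_tsupport fun x hx => ?_
    have hsub : (Function.support fun x => b x ^ 2 / Metric.infDist x Ωᶜ ^ 2) ⊆
        Function.support b := fun y hy h0 => hy (by simp [h0])
    have hx' : x ∈ tsupport b := closure_mono hsub hx
    exact (b.continuous.continuousAt.pow 2).div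
      ((Metric.continuous_infDist_pt _).continuousAt.pow 2) (pow_ne_zero 2 (hdpos x (hbs hx')))
  have hpos : 0 < ∫ x in Ω, b x ^ 2 / Metric.infDist x Ωᶜ ^ 2 := by
    rw [setIntegral_eq_integral_of_forall_compl_eq_zero fun x hx => by rw [hb0 x hx]; simp]
    refine hcont.integral_pos_of_hasCompactSupport_nonneg_nonzero hcs
      (fun x => by positivity) (x := x₀) ?_
    have h1 : b x₀ = 1 := b.one_of_mem_closedBall (Metric.mem_closedBall_self b.rIn_pos.le)
    rw [h1]
    exact div_ne_zero (by norm_num) (pow_ne_zero 2 (hdpos x₀ hx₀))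
  refine ⟨(∫ x in Ω, ‖gradient b x‖ ^ 2) / ∫ x in Ω, b x ^ 2 / Metric.infDist x Ωᶜ ^ 2, ?_⟩
  rintro c ⟨-, hcb⟩
  rw [le_div_iff₀ hpos]
  exact hcb b b.contDiff b.hasCompactSupport hbs

theorem hardyConst_nonneg {n : ℕ} (Ω : Set (EuclideanSpace ℝ (Fin n))) : 0 ≤ hardyConst Ω :=
  Real.sSup_nonneg fun _ hc => hc.1

theorem one_sixteenth_le_hardyConst {Ω : Set (EuclideanSpace ℝ (Fin 2))} (hΩo : IsOpen Ω)
    (hΩc : IsSimplyConnected Ω) (hΩ : Ω ≠ Set.univ) : 1 / 16 ≤ hardyConst Ω := by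
  refine le_csSup (bddAbove_hardyConst_set hΩo hΩc.nonempty hΩ) ⟨by norm_num, ?_⟩
  intro u hu hc hs
  exact hardy_inequality_plane hΩo hΩc hΩ (hu.of_le (by exact_mod_cast le_top)) hc hs

theorem isOpen_slitPlane : IsOpen slitPlane := by
  refine isOpen_univ.sdiff ?_
  have hc : ∀ i, Continuous fun x : EuclideanSpace ℝ (Fin 2) => x i := fun i => by fun_prop
  exact (isClosed_eq (hc 1) continuous_const).inter (isClosed_le continuous_const (hc 0))

theorem slitPlane_ne_univ : slitPlane ≠ Set.univ := fun h => by
  have : (0 : EuclideanSpace ℝ (Fin 2)) ∈ slitPlane := h ▸ Set.mem_univ _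
  exact this.2 (by simp)

theorem mem_slitPlane_neg_one : !₂[(-1 : ℝ), 0] ∈ slitPlane := by
  refine ⟨Set.mem_univ _, fun h => ?_⟩
  have := h.2
  simp at this
  linarith

theorem starConvex_slitPlane : StarConvex ℝ !₂[(-1 : ℝ), 0] slitPlane := by
  intro y hy a b ha hb hab
  refine ⟨Set.mem_univ _, fun h => ?_⟩
  obtain ⟨h1, h2⟩ := h
  simp only [PiLp.add_apply, PiLp.smul_apply, smul_eq_mul, Matrix.cons_val_zero,
    Matrix.cons_val_one] at h1 h2
  have hb0 : b ≠ 0 := by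
    rintro rfl
    norm_num at h2
    linarith
  have hbpos : 0 < b := lt_of_le_of_ne hb hb0.symm
  refine hy.2 ⟨?_, ?_⟩
  · simpa [hb0] using h1
  · have : 0 ≤ b * y 0 := by linarith
    exact nonneg_of_mul_nonneg_right this hbpos

theorem isSimplyConnected_slitPlane : IsSimplyConnected slitPlane :=
  isSimplyConnected_of_starConvex starConvex_slitPlane ⟨_, mem_slitPlane_neg_one⟩

/-- **Known bounds on the uniform Hardy constant for simply connected planar domains:**
`1/16 ≤ H* ≤ H(Λ_{2π})`, where `Λ_{2π}` is the slit plane. -/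
theorem simplyConnectedHardyConst_bounds :
    1 / 16 ≤ simplyConnectedHardyConst ∧
    simplyConnectedHardyConst ≤ hardyConst slitPlane := by
  constructor
  · refine le_csInf ⟨_, slitPlane, isOpen_slitPlane, ⟨_, mem_slitPlane_neg_one⟩,
      slitPlane_ne_univ, isSimplyConnected_slitPlane, rfl⟩ ?_
    rintro c ⟨Ω, hΩo, -, hΩ, hΩc, rfl⟩
    exact one_sixteenth_le_hardyConst hΩo hΩc hΩ
  · refine csInf_le ⟨0, ?_⟩ ⟨slitPlane, isOpen_slitPlane, ⟨_, mem_slitPlane_neg_one⟩,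
      slitPlane_ne_univ, isSimplyConnected_slitPlane, rfl⟩
    rintro c ⟨Ω, -, -, -, -, rfl⟩
    exact hardyConst_nonneg Ω
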